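/- arXiv:2104.00156 — 2 statements merged into one kernel-verified Lean document; each statement's English description precedes it below -/
import Mathlib

section
/- Fix n distinct rational numbers α_1,…,α_n and 1 ≤ k ≤ n. Then the ideals J_{n,k} and T(X_{n,k}) of ℚ[x_1,…,x_n] are equal. -/
open scoped BigOperators

namespace PackedWords

/-- An ordered set partition of `[n] = {1, …, n}` with `k` blocks: a sequence
`B_1 | ⋯ | B_k` of nonempty pairwise disjoint subsets of `[n]` whose union is `[n]`. -/
structure OSP (n k : ℕ) where
  blocks : Fin k → Finset ℕ
  subset_range : ∀ j, blocks j ⊆ Finset.Icc 1 n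
  blocks_nonempty : ∀ j, (blocks j).Nonempty
  blocks_disjoint : ∀ j₁ j₂ : Fin k, j₁ ≠ j₂ → Disjoint (blocks j₁) (blocks j₂)
  cover : ∀ i ∈ Finset.Icc 1 n, ∃ j, i ∈ blocks j

/-- Common generalization of the coinversion code (`b = 0`) and the boosted
coinversion code (`b = 1`).  Position `p : Fin n` corresponds to the letter
`i = p + 1` of `[n]`.  If `i ∈ B_j` (blocks indexed `0, …, k-1`, so `j` here is
the paper's `j - 1`), then `c_i = #{ℓ > j : min B_ℓ > i}` if `i = min B_j`, and
`c_i = #{ℓ > j : min B_ℓ > i} + (j - 1) + b` (in the paper's 1-indexing) otherwise. -/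
noncomputable def codeAux {n k : ℕ} (b : ℕ) (σ : OSP n k) (p : Fin n) : ℕ :=
  if h : ∃ j, ((p : ℕ) + 1) ∈ σ.blocks j then
    (Finset.univ.filter fun ℓ : Fin k =>
        h.choose < ℓ ∧ ∀ x ∈ σ.blocks ℓ, (p : ℕ) + 1 < x).card
      + (if ∀ x ∈ σ.blocks h.choose, (p : ℕ) + 1 ≤ x then 0 else (h.choose : ℕ) + b)
  else 0

/-- The coinversion code of an ordered set partition. -/
noncomputable def code {n k : ℕ} (σ : OSP n k) : Fin n → ℕ := codeAux 0 σ

/-- The boosted coinversion code of an ordered set partition. -/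
noncomputable def bcode {n k : ℕ} (σ : OSP n k) : Fin n → ℕ := codeAux 1 σ

/-- The skip sequence of a finite set `S = {s_1 < s_2 < ⋯} ⊆ ℕ`:
`γ_i = i - j + 1` if `i = s_j ∈ S`, and `γ_i = 0` otherwise. -/
def skip (S : Finset ℕ) (i : ℕ) : ℕ :=
  if i ∈ S then i - (S.filter (· < i)).card else 0

/-- The reverse skip sequence `γ(S)* = (γ_n, …, γ_1)` of `S ⊆ [n]`, read at
position `p : Fin n` (so position `p` carries `γ_{n - p}` in 1-indexed terms). -/
def revSkipAt (n : ℕ) (S : Finset ℕ) (p : Fin n) : ℕ := skip S (n - (p : ℕ))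

/-- For `T ⊆ [n-1]` with skip sequence `γ = γ(T)`, the length-`n` sequence
`(γ_{n-1}, …, γ_i, d, γ_{i-1}, …, γ_1)` obtained from the reverse skip sequence of `T`
by inserting `d` in position `n - i + 1` (1-indexed), read at position `p : Fin n`. -/
def insSeq (n i d : ℕ) (T : Finset ℕ) (p : Fin n) : ℕ :=
  if (p : ℕ) + 1 ≤ n - i then skip T (n - ((p : ℕ) + 1))
  else if (p : ℕ) + 1 = n - i + 1 then d
  else skip T (n - ((p : ℕ) + 1) + 1)

/-- `Packedk n k w`: `w` is a packed word of length `n` on the alphabet of positive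
integers (whenever `i + 1` appears as a letter, so does `i`) in which each of the
letters `1, 2, …, k` appears. -/
def Packedk (n k : ℕ) (w : Fin n → ℕ) : Prop :=
  (∀ p, 1 ≤ w p) ∧ (∀ i, 1 ≤ i → (∃ p, w p = i + 1) → ∃ p, w p = i) ∧
    (∀ j, 1 ≤ j → j ≤ k → ∃ p, w p = j)

/-- The elementary symmetric polynomial of degree `a` in the variables `X j`, `j ∈ s`. -/
noncomputable def esymmOn (n : ℕ) (s : Finset (Fin n)) (a : ℕ) : MvPolynomial (Fin n) ℚ :=
  ∑ t ∈ s.powersetCard a, ∏ j ∈ t, MvPolynomial.X j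

/-- The complete homogeneous symmetric polynomial of degree `b` evaluated at
`α 1, α 2, …, α d`. -/
noncomputable def hval (b d : ℕ) (α : ℕ → ℚ) : ℚ :=
  ∑ m : Sym (Fin d) b, ((m : Multiset (Fin d)).map fun j => α ((j : ℕ) + 1)).prod

/-- The locus `X_{n,k} ⊆ ℚ^n` of points `(α_{w_1}, …, α_{w_n})` for `w ∈ W_{n,k}`. -/
def packedPoints (n k : ℕ) (α : ℕ → ℚ) : Set (Fin n → ℚ) :=
  {x | ∃ w : Fin n → ℕ, Packedk n k w ∧ x = fun p => α (w p)}

/-- The ideal `J_n = ⟨x_i^d e_{n-r}^{(i)} : 1 ≤ i ≤ n, 1 ≤ r ≤ d⟩`. -/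
noncomputable def Jn (n : ℕ) : Ideal (MvPolynomial (Fin n) ℚ) :=
  Ideal.span {g | ∃ (i : Fin n) (r d : ℕ), 1 ≤ r ∧ r ≤ d ∧
    g = MvPolynomial.X i ^ d * esymmOn n {i}ᶜ (n - r)}

/-- The ideal `J_{n,k} = J_n + ⟨e_n, e_{n-1}, …, e_{n-k+1}⟩`. -/
noncomputable def Jnk (n k : ℕ) : Ideal (MvPolynomial (Fin n) ℚ) :=
  Jn n ⊔ Ideal.span {g | ∃ j : ℕ, n - k + 1 ≤ j ∧ j ≤ n ∧ g = esymmOn n Finset.univ j}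

/-- The Haglund–Rhoades–Shimozono ideal
`I_{n,k} = ⟨x_1^k, …, x_n^k, e_n, e_{n-1}, …, e_{n-k+1}⟩`. -/
noncomputable def Ink (n k : ℕ) : Ideal (MvPolynomial (Fin n) ℚ) :=
  Ideal.span ({g | ∃ i : Fin n, g = MvPolynomial.X i ^ k} ∪
    {g | ∃ j : ℕ, n - k + 1 ≤ j ∧ j ≤ n ∧ g = esymmOn n Finset.univ j})

/-- `T(X)`: the ideal generated by the top-degree homogeneous components `τ(f)` of
all nonzero polynomials `f` vanishing on `X`. -/
noncomputable def gradedIdeal (n : ℕ) (X : Set (Fin n → ℚ)) : Ideal (MvPolynomial (Fin n) ℚ) :=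
  Ideal.span {g | ∃ f : MvPolynomial (Fin n) ℚ, f ≠ 0 ∧
    (∀ x ∈ X, MvPolynomial.eval x f = 0) ∧
    g = MvPolynomial.homogeneousComponent f.totalDegree f}

/-- The degree-`d` homogeneous component of the quotient `ℚ[x_1, …, x_n]/I`,
namely the image of the space of homogeneous polynomials of degree `d`. -/
noncomputable def quotComp (n : ℕ) (I : Ideal (MvPolynomial (Fin n) ℚ)) (d : ℕ) :
    Submodule ℚ (MvPolynomial (Fin n) ℚ ⧸ I) :=
  Submodule.map (Ideal.Quotient.mkₐ ℚ I).toLinearMap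
    (MvPolynomial.homogeneousSubmodule (Fin n) ℚ d)

/-- The degree-`(d - a)` homogeneous component of `ℚ[x_1, …, x_n]/I`, interpreted as
zero when `d - a < 0` (degree shift by `a`). -/
noncomputable def quotCompShift (n : ℕ) (I : Ideal (MvPolynomial (Fin n) ℚ)) (d a : ℕ) :
    Submodule ℚ (MvPolynomial (Fin n) ℚ ⧸ I) :=
  if a ≤ d then quotComp n I (d - a) else ⊥

lemma packedk_comp {n k : ℕ} {w : Fin n → ℕ} (σ : Equiv.Perm (Fin n)) (h : Packedk n k w) :
    Packedk n k (w ∘ σ) := by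
  obtain ⟨h1, h2, h3⟩ := h
  refine ⟨fun p => h1 _, fun i hi hex => ?_, fun j hj hjk => ?_⟩
  · obtain ⟨q, hq⟩ := h2 i hi (by obtain ⟨p, hp⟩ := hex; exact ⟨σ p, hp⟩)
    exact ⟨σ.symm q, by simpa using hq⟩
  · obtain ⟨q, hq⟩ := h3 j hj hjk
    exact ⟨σ.symm q, by simpa using hq⟩

/-- The left action of a permutation `σ ∈ S_n` on packed words, sending `w` to
`w ∘ σ⁻¹` (the permutation action on positions). -/
noncomputable def wordPerm (n k : ℕ) (σ : Equiv.Perm (Fin n)) :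
    {w : Fin n → ℕ // Packedk n k w} ≃ {w : Fin n → ℕ // Packedk n k w} where
  toFun w := ⟨w.1 ∘ σ.symm, packedk_comp σ.symm w.2⟩
  invFun w := ⟨w.1 ∘ σ, packedk_comp σ w.2⟩
  left_inv w := Subtype.ext (funext fun p => by simp)
  right_inv w := Subtype.ext (funext fun p => by simp)

open Polynomial in
/-- The minor on the rows `a` of the Toeplitz matrix of coefficients of `P, X * P, …, X ^ s * P`. -/
noncomputable def shiftMinor {A : Type*} [CommRing A] (P : Polynomial A) (s : ℕ)
    (a : Fin (s + 1) → ℕ) : A :=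
  (Matrix.of fun i j : Fin (s + 1) => (X ^ (j : ℕ) * P).coeff (a i)).det

/-- The ideal generated by the minors of the `k × (s + 1)` matrix of the coefficients of
`P, X * P, …, X ^ s * P` in degrees less than `k`. -/
noncomputable def minorIdeal {A : Type*} [CommRing A] (P : Polynomial A) (s k : ℕ) : Ideal A :=
  Ideal.span {g | ∃ a : Fin (s + 1) → ℕ, (∀ i, a i < k) ∧ g = shiftMinor P s a}

section Minors

open Polynomial

variable {A : Type*} [CommRing A]

lemma shiftMinor_mem_minorIdeal (P : A[X]) {s k : ℕ} {a : Fin (s + 1) → ℕ} (ha : ∀ i, a i < k) :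
    shiftMinor P s a ∈ minorIdeal P s k :=
  Ideal.subset_span ⟨a, ha, rfl⟩

lemma shiftMinor_map {B : Type*} [CommRing B] (f : A →+* B) (P : A[X]) (s : ℕ)
    (a : Fin (s + 1) → ℕ) : shiftMinor (P.map f) s a = f (shiftMinor P s a) := by
  rw [shiftMinor, shiftMinor, RingHom.map_det]
  congr 1
  ext i j
  simp [← Polynomial.coeff_map, Polynomial.map_mul]

lemma minorIdeal_map {B : Type*} [CommRing B] (f : A →+* B) (P : A[X]) (s k : ℕ) :
    (minorIdeal P s k).map f = minorIdeal (P.map f) s k := by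
  rw [minorIdeal, minorIdeal, Ideal.map_span]
  congr 1
  ext g
  constructor
  · rintro ⟨_, ⟨a, ha, rfl⟩, rfl⟩
    exact ⟨a, ha, (shiftMinor_map f P s a).symm⟩
  · rintro ⟨a, ha, rfl⟩
    exact ⟨_, ⟨a, ha, rfl⟩, (shiftMinor_map f P s a).symm⟩

lemma shiftMinor_natDegree_add {P : A[X]} (hP : P.Monic) (s : ℕ) :
    shiftMinor P s (fun i => P.natDegree + i) = 1 := by
  rw [shiftMinor, Matrix.det_of_isUpperTriangular]
  · refine Finset.prod_eq_one fun i _ => ?_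
    simp [Polynomial.coeff_X_pow_mul', hP.coeff_natDegree]
  · intro i j hij
    have hij : j < i := hij
    rw [Matrix.of_apply, Polynomial.coeff_X_pow_mul', if_pos (by omega)]
    exact Polynomial.coeff_eq_zero_of_natDegree_lt (by omega)

lemma minorIdeal_eq_top {P : A[X]} (hP : P.Monic) {s k : ℕ} (h : P.natDegree + s < k) :
    minorIdeal P s k = ⊤ := by
  rw [Ideal.eq_top_iff_one, ← shiftMinor_natDegree_add hP s]
  exact shiftMinor_mem_minorIdeal P fun i => by omega

lemma shiftMinor_zero (P : A[X]) (a : Fin 1 → ℕ) : shiftMinor P 0 a = P.coeff (a 0) := by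
  simp [shiftMinor]

/-- Adjoining a linear factor turns maximal minors with one column fewer into generators of the
ideal containing the larger minors. -/
lemma shiftMinor_succ_mem (P : A[X]) (x : A) (s k : ℕ) {a : Fin (s + 2) → ℕ} (ha : ∀ i, a i < k) :
    shiftMinor P (s + 1) a ∈ minorIdeal ((X + C x) * P) s k := by
  rw [shiftMinor, Matrix.det_eq_of_forall_col_eq_smul_add_pred
    (B := Matrix.of fun i j => Fin.cases (P.coeff (a i))
      (fun j : Fin (s + 1) => (X ^ (j : ℕ) * ((X + C x) * P)).coeff (a i)) j) (c := fun _ => -x)]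
  · rw [Matrix.det_succ_column_zero]
    refine Ideal.sum_mem _ fun i _ => Ideal.mul_mem_left _ _ ?_
    exact shiftMinor_mem_minorIdeal ((X + C x) * P) (a := fun j => a (i.succAbove j))
      fun j => ha _
  · intro i
    simp
  · intro i j
    have : X ^ (j : ℕ) * ((X + C x) * P) = X ^ ((j : ℕ) + 1) * P + C x * (X ^ (j : ℕ) * P) := by
      ring
    simp [this]

lemma minorIdeal_succ_le (P : A[X]) (x : A) (s k : ℕ) :
    minorIdeal P (s + 1) k ≤ minorIdeal ((X + C x) * P) s k :=
  Ideal.span_le.2 fun _ ⟨_, ha, hg⟩ => hg ▸ shiftMinor_succ_mem P x s k ha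

lemma exists_shiftMinor_eq (P : A[X]) (s : ℕ) (a : Fin (s + 1) → ℕ) :
    (shiftMinor ((X + C (X : A[X])) * P.map C) s a).natDegree ≤ s + 1 ∧
      (shiftMinor ((X + C (X : A[X])) * P.map C) s a).coeff (s + 1) = shiftMinor P s a := by
  have h : shiftMinor ((X + C (X : A[X])) * P.map C) s a =
      Matrix.det ((X : A[X]) •
        (Matrix.of fun i j : Fin (s + 1) => (X ^ (j : ℕ) * P).coeff (a i)).map C +
        (Matrix.of fun i j : Fin (s + 1) => (X ^ ((j : ℕ) + 1) * P).coeff (a i)).map C) := by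
    rw [shiftMinor]
    congr 1
    ext1 i j
    have : (X ^ (j : ℕ) * ((X + C (X : A[X])) * P.map C)) =
        (X ^ ((j : ℕ) + 1) * P).map C + C X * (X ^ (j : ℕ) * P).map C := by
      simp only [Polynomial.map_mul, Polynomial.map_pow, Polynomial.map_X]
      ring
    rw [Matrix.of_apply, this, coeff_add, coeff_C_mul, coeff_map, coeff_map]
    simp [add_comm]
  rw [h]
  refine ⟨(natDegree_det_X_add_C_le _ _).trans (by simp), ?_⟩
  have hc := coeff_det_X_add_C_card
    (Matrix.of fun i j : Fin (s + 1) => (X ^ (j : ℕ) * P).coeff (a i))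
    (Matrix.of fun i j : Fin (s + 1) => (X ^ ((j : ℕ) + 1) * P).coeff (a i))
  rwa [Fintype.card_fin] at hc

lemma coeff_mem_leadingCoeffNth {I : Ideal A[X]} {p : A[X]} (hp : p ∈ I) {d : ℕ}
    (hd : p.natDegree ≤ d) : p.coeff d ∈ I.leadingCoeffNth d :=
  ⟨p, ⟨mem_degreeLE.2 (natDegree_le_iff_degree_le.1 hd), hp⟩, rfl⟩

end Minors

open Polynomial in
/-- The polynomial `∏ (T + y j)` over all `j ≠ i`. -/
noncomputable def omitProd {A : Type*} [CommRing A] {m : ℕ} (y : Fin m → A) (i : Fin m) :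
    Polynomial A :=
  ∏ j, if j = i then 1 else X + C (y j)

open Polynomial in
/-- The ideal of top degree relations of the words `w` of length `m` on the letters `0, 1, …`, with
`D` distinct letters, such that all letters are less than `D + s` and `k ≤ D + s`. -/
noncomputable def wordIdeal {A : Type*} [CommRing A] {m : ℕ} (y : Fin m → A) (s k : ℕ) : Ideal A :=
  minorIdeal (∏ i, (X + C (y i))) s k ⊔
    ⨆ i, ⨆ d, Ideal.span {y i ^ d} * minorIdeal (omitProd y i) s d

section WordIdeal

open Polynomial

variable {A : Type*} [CommRing A] {m : ℕ}

lemma monic_prod_X_add_C (y : Fin m → A) : (∏ i, (X + C (y i))).Monic :=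
  monic_prod_of_monic _ _ fun _ _ => monic_X_add_C _

lemma natDegree_prod_X_add_C_le (y : Fin m → A) : (∏ i, (X + C (y i))).natDegree ≤ m := by
  refine (natDegree_prod_le _ _).trans ((Finset.sum_le_sum fun i _ =>
    natDegree_add_C.trans_le natDegree_X_le).trans ?_)
  simp

lemma minorIdeal_prod_eq_top (y : Fin m → A) {s k : ℕ} (h : m + s < k) :
    minorIdeal (∏ i, (X + C (y i))) s k = ⊤ :=
  minorIdeal_eq_top (monic_prod_X_add_C y) (by have := natDegree_prod_X_add_C_le y; omega)

lemma wordIdeal_eq_top (y : Fin m → A) {s k : ℕ} (h : m + s < k) : wordIdeal y s k = ⊤ := by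
  rw [wordIdeal, minorIdeal_prod_eq_top y h, top_sup_eq]

lemma wordIdeal_map {B : Type*} [CommRing B] (f : A →+* B) (y : Fin m → A) (s k : ℕ) :
    (wordIdeal y s k).map f = wordIdeal (fun i => f (y i)) s k := by
  have h (i) : (omitProd y i).map f = omitProd (fun j => f (y j)) i := by
    rw [omitProd, omitProd, Polynomial.map_prod]
    refine Finset.prod_congr rfl fun j _ => ?_
    split_ifs <;> simp
  simp only [wordIdeal, Ideal.map_sup, Ideal.map_iSup, Ideal.map_mul, minorIdeal_map,
    Ideal.map_span, Set.image_singleton, map_pow, h, Polynomial.map_prod, Polynomial.map_add,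
    Polynomial.map_X, Polynomial.map_C]

lemma prod_le_wordIdeal (y : Fin m → A) (s k : ℕ) :
    minorIdeal (∏ i, (X + C (y i))) s k ≤ wordIdeal y s k :=
  le_sup_left

lemma omit_le_wordIdeal (y : Fin m → A) (s k d : ℕ) (i : Fin m) :
    Ideal.span {y i ^ d} * minorIdeal (omitProd y i) s d ≤ wordIdeal y s k :=
  (le_iSup₂ (f := fun i d => Ideal.span {y i ^ d} * minorIdeal (omitProd y i) s d) i d).trans
    le_sup_right

lemma mul_mem_wordIdeal (y : Fin m → A) {s k d : ℕ} (i : Fin m) {g : A}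
    (hg : g ∈ minorIdeal (omitProd y i) s d) : y i ^ d * g ∈ wordIdeal y s k :=
  omit_le_wordIdeal y s k d i (Ideal.mul_mem_mul (Ideal.mem_span_singleton_self _) hg)

lemma wordIdeal_le_iff {y : Fin m → A} {s k : ℕ} {I : Ideal A} :
    wordIdeal y s k ≤ I ↔ (minorIdeal (∏ i, (X + C (y i))) s k ≤ I ∧
      ∀ i d, ∀ g ∈ minorIdeal (omitProd y i) s d, y i ^ d * g ∈ I) := by
  simp only [wordIdeal, sup_le_iff, iSup_le_iff, Ideal.span_singleton_mul_le_iff]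

/-- The variables of `A[X]` obtained by adjoining `X` in front of the variables of `A`. -/
noncomputable def consX (y : Fin m → A) : Fin (m + 1) → A[X] :=
  Fin.cons X fun i => C (y i)

lemma prod_consX (y : Fin m → A) : ∏ i, (X + C (consX y i)) =
    (X + C (X : A[X])) * (∏ i, (X + C (y i))).map C := by
  simp [Fin.prod_univ_succ, consX, Polynomial.map_prod]

lemma omitProd_consX_zero (y : Fin m → A) :
    omitProd (consX y) 0 = (∏ i, (X + C (y i))).map C := by
  simp [omitProd, Fin.prod_univ_succ, consX, Polynomial.map_prod]

lemma omitProd_consX_succ (y : Fin m → A) (i : Fin m) :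
    omitProd (consX y) i.succ = (X + C (X : A[X])) * (omitProd y i).map C := by
  rw [omitProd, omitProd, Fin.prod_univ_succ, Polynomial.map_prod]
  simp only [(Fin.succ_ne_zero i).symm, if_false, Fin.succ_inj, consX, Fin.cons_zero, Fin.cons_succ]
  congr 1
  refine Finset.prod_congr rfl fun j _ => ?_
  split_ifs <;> simp

lemma C_mem_minorIdeal_of_succ (P : A[X]) {s k : ℕ} {g : A} (hg : g ∈ minorIdeal P (s + 1) k) :
    C g ∈ minorIdeal ((X + C (X : A[X])) * P.map C) s k := by
  refine minorIdeal_succ_le _ X s k ?_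
  rw [← minorIdeal_map]
  exact Ideal.mem_map_of_mem C hg

lemma wordIdeal_succ_le_leadingCoeffNth (y : Fin m → A) (s k d : ℕ) :
    wordIdeal y (s + 1) k ≤ (wordIdeal (consX y) s k).leadingCoeffNth d := by
  refine le_trans ?_ (Ideal.leadingCoeffNth_mono _ (Nat.zero_le d))
  rw [wordIdeal_le_iff]
  refine ⟨fun g hg => ?_, fun i e g hg => ?_⟩ <;> rw [Ideal.mem_leadingCoeffNth_zero]
  · refine prod_le_wordIdeal _ _ _ ?_
    rw [prod_consX]
    exact C_mem_minorIdeal_of_succ _ hg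
  · have := mul_mem_wordIdeal (consX y) (s := s) (k := k) (d := e) i.succ (g := C g)
      (by rw [omitProd_consX_succ]; exact C_mem_minorIdeal_of_succ _ hg)
    simpa [consX] using this

lemma mul_mem_leadingCoeffNth (P : A[X]) {s k : ℕ} {g : A} (hg : g ∈ minorIdeal P s k)
    {I : Ideal A[X]} (t : A)
    (h : ∀ p ∈ minorIdeal ((X + C (X : A[X])) * P.map C) s k, C t * p ∈ I) :
    t * g ∈ I.leadingCoeffNth (s + 1) := by
  suffices Ideal.span {t} * minorIdeal P s k ≤ I.leadingCoeffNth (s + 1) from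
    this (Ideal.mul_mem_mul (Ideal.mem_span_singleton_self t) hg)
  rw [minorIdeal, Ideal.span_mul_span, Ideal.span_le]
  rintro _ ⟨_, rfl, _, ⟨a, ha, rfl⟩, rfl⟩
  obtain ⟨hdeg, hcoeff⟩ := exists_shiftMinor_eq P s a
  simp only [SetLike.mem_coe]
  rw [← hcoeff, ← coeff_C_mul]
  exact coeff_mem_leadingCoeffNth (h _ (shiftMinor_mem_minorIdeal _ ha))
    ((natDegree_C_mul_le _ _).trans hdeg)

lemma wordIdeal_max_le_leadingCoeffNth (y : Fin m → A) (s k d : ℕ) (hd : s + 1 ≤ d) :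
    wordIdeal y s (max k d) ≤ (wordIdeal (consX y) s k).leadingCoeffNth d := by
  rw [wordIdeal_le_iff]
  refine ⟨?_, fun i e g hg => ?_⟩
  · rcases le_total k d with h | h
    · rw [max_eq_right h]
      intro g hg
      have := mul_mem_wordIdeal (consX y) (s := s) (k := k) (d := d) 0 (g := C g) (by
        rw [omitProd_consX_zero, ← minorIdeal_map]
        exact Ideal.mem_map_of_mem C hg)
      have h2 := coeff_mem_leadingCoeffNth (d := d) this (by
        simp only [consX, Fin.cons_zero]
        exact (natDegree_mul_C_le _ _).trans (natDegree_X_pow_le _))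
      simpa [consX] using h2
    · rw [max_eq_left h]
      intro g hg
      refine Ideal.leadingCoeffNth_mono _ hd ?_
      rw [← one_mul g]
      refine mul_mem_leadingCoeffNth _ hg 1 fun p hp => ?_
      rw [C_1, one_mul]
      refine prod_le_wordIdeal _ _ _ ?_
      rwa [prod_consX]
  · refine Ideal.leadingCoeffNth_mono _ hd (mul_mem_leadingCoeffNth _ hg _ fun p hp => ?_)
    have := mul_mem_wordIdeal (consX y) (s := s) (k := k) (d := e) i.succ (g := p)
      (by rwa [omitProd_consX_succ])
    simpa [consX] using this

end WordIdeal

/-- The words `w` of length `m` on the letters `0, 1, …`, with `D` distinct letters, such that all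
letters are less than `D + s` and `k ≤ D + s`. -/
def words (m s k : ℕ) : Finset (Fin m → ℕ) :=
  {w ∈ Fintype.piFinset fun _ => Finset.range (m + s) |
    (∀ p, w p < (Finset.univ.image w).card + s) ∧ k ≤ (Finset.univ.image w).card + s}

lemma card_image_le (m : ℕ) (w : Fin m → ℕ) : (Finset.univ.image w).card ≤ m :=
  Finset.card_image_le.trans (by simp)

lemma mem_words {m s k : ℕ} {w : Fin m → ℕ} : w ∈ words m s k ↔
    (∀ p, w p < (Finset.univ.image w).card + s) ∧ k ≤ (Finset.univ.image w).card + s := by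
  simp only [words, Finset.mem_filter, Fintype.mem_piFinset, Finset.mem_range,
    and_iff_right_iff_imp]
  intro h p
  have := h.1 p
  have := card_image_le m w
  omega

/-- The words contributing a monomial with exponent `d` in the first variable. -/
def level (m s k d : ℕ) : Finset (Fin m → ℕ) :=
  if d ≤ s then words m (s + 1) k else words m s (max k d)

lemma level_subset (m s k d : ℕ) : level m s k d ⊆ words m (s + 1) k := by
  rw [level]
  split_ifs with h
  · exact subset_rfl
  · intro w
    simp only [mem_words, max_le_iff]
    rintro ⟨h1, h2, -⟩
    exact ⟨fun p => (h1 p).trans (by omega), by omega⟩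

lemma image_cons {m : ℕ} (j : ℕ) (w : Fin m → ℕ) :
    Finset.univ.image (Fin.cons j w : Fin (m + 1) → ℕ) = insert j (Finset.univ.image w) := by
  ext x
  simp [Fin.exists_fin_succ, eq_comm]

lemma card_level_le_card_cons {m s k : ℕ} {w : Fin m → ℕ} (hw : w ∈ words m (s + 1) k) :
    ({d ∈ Finset.range (m + s + 1) | w ∈ level m s k d}).card ≤
      ({j ∈ Finset.range (m + s + 1) |
        (Fin.cons j w : Fin (m + 1) → ℕ) ∈ words (m + 1) s k}).card := by
  have hD := card_image_le m w
  have hcons (j : ℕ) : (Fin.cons j w : Fin (m + 1) → ℕ) ∈ words (m + 1) s k ↔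
      (j < (insert j (Finset.univ.image w)).card + s ∧
        ∀ p, w p < (insert j (Finset.univ.image w)).card + s) ∧
        k ≤ (insert j (Finset.univ.image w)).card + s := by
    rw [mem_words, image_cons, Fin.forall_fin_succ]
    simp
  by_cases h : w ∈ words m s k
  · refine Finset.card_le_card fun d => ?_
    rw [mem_words] at h
    simp only [Finset.mem_filter, Finset.mem_range, hcons]
    rintro ⟨hd, hl⟩
    have hdD : d ≤ (Finset.univ.image w).card + s := by
      rw [level] at hl
      split_ifs at hl with hds
      · omega
      · exact (le_max_right k d).trans (mem_words.1 hl).2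
    have hle := Finset.card_le_card (Finset.subset_insert d (Finset.univ.image w))
    refine ⟨hd, ⟨?_, fun p => (h.1 p).trans_le (by omega)⟩, by omega⟩
    by_cases hmem : d ∈ Finset.univ.image w
    · obtain ⟨p, -, rfl⟩ := Finset.mem_image.1 hmem
      exact (h.1 p).trans_le (by omega)
    · rw [Finset.card_insert_of_notMem hmem]
      omega
  · have hle : ({d ∈ Finset.range (m + s + 1) | w ∈ level m s k d}).card ≤ s + 1 := by
      rw [← Finset.card_range (s + 1)]
      refine Finset.card_le_card fun d => ?_
      rw [Finset.mem_filter, Finset.mem_range, level]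
      rintro ⟨-, hl⟩
      by_contra hd
      rw [Finset.mem_range] at hd
      rw [if_neg (by omega), mem_words] at hl
      exact h (mem_words.2 ⟨hl.1, (le_max_left k d).trans hl.2⟩)
    have hge := Finset.le_card_sdiff (Finset.univ.image w)
      (Finset.range ((Finset.univ.image w).card + s + 1))
    rw [Finset.card_range] at hge
    refine (hle.trans (by omega)).trans (hge.trans (Finset.card_le_card fun j => ?_))
    rw [mem_words] at hw
    simp only [Finset.mem_filter, Finset.mem_range, hcons, Finset.mem_sdiff]
    rintro ⟨hj, hmem⟩
    rw [Finset.card_insert_of_notMem hmem]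
    exact ⟨by omega, ⟨by omega, fun p => (hw.1 p).trans_le (by omega)⟩, by omega⟩

lemma sum_card_level_le (m s k : ℕ) :
    ∑ d ∈ Finset.range (m + s + 1), (level m s k d).card ≤ (words (m + 1) s k).card := by
  calc
    _ = ∑ d ∈ Finset.range (m + s + 1), ({w ∈ words m (s + 1) k | w ∈ level m s k d}).card := by
      refine Finset.sum_congr rfl fun d _ => ?_
      rw [Finset.filter_mem_eq_inter, Finset.inter_eq_right.2 (level_subset m s k d)]
    _ = ∑ w ∈ words m (s + 1) k, ({d ∈ Finset.range (m + s + 1) | w ∈ level m s k d}).card :=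
      (Finset.sum_card_bipartiteAbove_eq_sum_card_bipartiteBelow
        fun w d => w ∈ level m s k d).symm
    _ ≤ ∑ w ∈ words m (s + 1) k, ({j ∈ Finset.range (m + s + 1) |
        (Fin.cons j w : Fin (m + 1) → ℕ) ∈ words (m + 1) s k}).card :=
      Finset.sum_le_sum fun w hw => card_level_le_card_cons hw
    _ ≤ _ := by
      rw [← Finset.card_sigma]
      refine Finset.card_le_card_of_injOn (fun q => (Fin.cons q.2 q.1 : Fin (m + 1) → ℕ)) ?_ ?_
      · intro q hq
        simp only [Finset.coe_sigma, Set.mem_sigma_iff, Finset.mem_coe, Finset.mem_filter] at hq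
        exact hq.2.2
      · rintro ⟨w, j⟩ - ⟨w', j'⟩ - h
        obtain ⟨rfl, rfl⟩ := Fin.cons_inj.1 h
        rfl

section Spanning

open MvPolynomial

/-- The monomials with exponents in `B` span the quotient by the ideal `I`. -/
def MonomialsSpan {m : ℕ} (B : Finset (Fin m →₀ ℕ)) (I : Ideal (MvPolynomial (Fin m) ℚ)) : Prop :=
  Submodule.span ℚ ((fun e => monomial e (1 : ℚ)) '' (B : Set (Fin m →₀ ℕ))) ⊔
    I.restrictScalars ℚ = ⊤

lemma finSuccEquiv_monomial_cons {m : ℕ} (d : ℕ) (e : Fin m →₀ ℕ) :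
    finSuccEquiv ℚ m (monomial (e.cons d) 1) = Polynomial.monomial d (monomial e 1) := by
  ext i f
  rw [finSuccEquiv_coeff_coeff, Polynomial.coeff_monomial]
  by_cases h : d = i
  · subst h
    simp [coeff_monomial, (Finsupp.cons_right_injective d).eq_iff]
  · have : e.cons d ≠ f.cons i := fun he => h (Finsupp.cons_injective2 he).1
    simp [h, coeff_monomial, this]

lemma wordIdeal_map_finSuccEquiv (m s k : ℕ) :
    (wordIdeal (X : Fin (m + 1) → MvPolynomial (Fin (m + 1)) ℚ) s k).map
      (finSuccEquiv ℚ m : MvPolynomial (Fin (m + 1)) ℚ →+* Polynomial (MvPolynomial (Fin m) ℚ)) =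
      wordIdeal (consX X) s k := by
  rw [wordIdeal_map]
  congr 1
  ext1 i
  refine Fin.cases ?_ (fun i => ?_) i
  · simp [consX, finSuccEquiv_X_zero]
  · simp [consX, finSuccEquiv_X_succ]

lemma monomialsSpan_biUnion {m N : ℕ} {I : Ideal (MvPolynomial (Fin (m + 1)) ℚ)}
    (B : ℕ → Finset (Fin m →₀ ℕ))
    (hB : ∀ d, MonomialsSpan (B d)
      ((I.map (finSuccEquiv ℚ m : _ →+* _)).leadingCoeffNth d))
    (hN : ∀ d, N ≤ d → B d = ∅) :
    MonomialsSpan ((Finset.range N).biUnion fun d => (B d).image (Finsupp.cons d)) I := by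
  set W := Submodule.span ℚ ((fun e => monomial e (1 : ℚ)) ''
    (((Finset.range N).biUnion fun d => (B d).image (Finsupp.cons d) :
      Finset (Fin (m + 1) →₀ ℕ)) : Set (Fin (m + 1) →₀ ℕ))) ⊔ I.restrictScalars ℚ with hW
  let φ := (finSuccEquiv ℚ m).symm
  have hlow (n : ℕ) (p : Polynomial (MvPolynomial (Fin m) ℚ))
      (h : ∀ d < n, ∀ g, φ (Polynomial.monomial d g) ∈ W) (hp : p.degree < n) : φ p ∈ W := by
    rcases eq_or_ne p 0 with rfl | h0
    · simp
    rw [p.as_sum_range' n ((Polynomial.natDegree_lt_iff_degree_lt h0).2 hp), map_sum]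
    exact Submodule.sum_mem _ fun d hd => h d (Finset.mem_range.1 hd) _
  have hmon (d : ℕ) : ∀ g, φ (Polynomial.monomial d g) ∈ W := by
    induction d using Nat.strong_induction_on with
    | _ d ih =>
    intro g
    have hg : g ∈ Submodule.span ℚ ((fun e => monomial e (1 : ℚ)) '' (B d : Set (Fin m →₀ ℕ))) ⊔
        ((I.map (finSuccEquiv ℚ m : _ →+* _)).leadingCoeffNth d).restrictScalars ℚ :=
      (hB d).symm ▸ Submodule.mem_top
    obtain ⟨b, hb, g', hg', rfl⟩ := Submodule.mem_sup.1 hg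
    clear hg
    rw [map_add, map_add]
    refine W.add_mem ?_ ?_
    · induction hb using Submodule.span_induction with
      | mem x hx =>
        obtain ⟨e, he, rfl⟩ := hx
        refine Submodule.mem_sup_left (Submodule.subset_span ⟨e.cons d, ?_, ?_⟩)
        · have hd : d < N := by
            by_contra hd
            simp [hN d (by omega)] at he
          simp only [Finset.coe_biUnion, Set.mem_iUnion, Finset.coe_image]
          exact ⟨d, by simpa using hd, e, he, rfl⟩
        · exact ((finSuccEquiv ℚ m).symm_apply_eq.2 (finSuccEquiv_monomial_cons d e).symm).symm
      | zero => simp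
      | add x y _ _ hx hy => rw [map_add, map_add]; exact W.add_mem hx hy
      | smul c x _ hx =>
        rw [← Polynomial.smul_monomial, map_smul]
        exact W.smul_mem c hx
    · obtain ⟨p, ⟨hdeg, hpI⟩, rfl⟩ := hg'
      have hpW : φ p ∈ W := by
        refine Submodule.mem_sup_right ?_
        obtain ⟨q, hq, rfl⟩ := (Ideal.mem_map_iff_of_surjective _
          (finSuccEquiv ℚ m).surjective).1 hpI
        simpa [φ] using hq
      have hsub : φ (p - Polynomial.monomial d (p.coeff d)) ∈ W := by
        refine hlow d _ ih (Polynomial.degree_lt_iff_coeff_zero _ _ |>.2 fun i hi => ?_)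
        rw [Polynomial.coeff_sub, Polynomial.coeff_monomial]
        split_ifs with h
        · rw [h, sub_self]
        · rw [Polynomial.coeff_eq_zero_of_degree_lt, sub_zero]
          exact (Polynomial.mem_degreeLE.1 hdeg).trans_lt (by exact_mod_cast hi.lt_of_ne h)
      have := W.sub_mem hpW hsub
      rw [← map_sub, sub_sub_cancel] at this
      exact this
  rw [MonomialsSpan, ← hW, eq_top_iff]
  intro f _
  have := hlow (((finSuccEquiv ℚ m) f).natDegree + 1) (finSuccEquiv ℚ m f) (fun d _ => hmon d)
    (by
      refine Polynomial.degree_le_natDegree.trans_lt ?_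
      exact_mod_cast Nat.lt_succ_self _)
  simpa [φ] using this

lemma MonomialsSpan.mono {m : ℕ} {B : Finset (Fin m →₀ ℕ)} {I J : Ideal (MvPolynomial (Fin m) ℚ)}
    (h : MonomialsSpan B I) (hIJ : I ≤ J) : MonomialsSpan B J := by
  rw [MonomialsSpan, eq_top_iff, ← h]
  exact sup_le_sup_left (fun _ hx => hIJ hx) _

lemma monomialsSpan_top {m : ℕ} (B : Finset (Fin m →₀ ℕ)) : MonomialsSpan B ⊤ := by
  simp [MonomialsSpan]

lemma exists_monomialsSpan (m : ℕ) : ∀ s k, ∃ B : Finset (Fin m →₀ ℕ),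
    B.card ≤ (words m s k).card ∧ MonomialsSpan B (wordIdeal X s k) := by
  induction m with
  | zero =>
    intro s k
    by_cases h : s < k
    · refine ⟨∅, by simp, ?_⟩
      rw [wordIdeal_eq_top _ (by omega)]
      exact monomialsSpan_top _
    · refine ⟨{0}, ?_, ?_⟩
      · rw [Finset.card_singleton, Nat.one_le_iff_ne_zero, Finset.card_ne_zero]
        exact ⟨Fin.elim0, mem_words.2 ⟨fun p => p.elim0, by omega⟩⟩
      · rw [MonomialsSpan, eq_top_iff]
        intro f _
        refine Submodule.mem_sup_left ?_
        rw [f.eq_C_of_isEmpty, C_apply, ← mul_one (coeff 0 f), ← smul_eq_mul, ← smul_monomial]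
        exact Submodule.smul_mem _ _ (Submodule.subset_span ⟨0, by simp, rfl⟩)
  | succ m ih =>
    intro s k
    choose! B hcard hspan using ih
    let B' (d : ℕ) : Finset (Fin m →₀ ℕ) :=
      if d ≤ s then B (s + 1) k else if d < m + s + 1 then B s (max k d) else ∅
    refine ⟨_, ?_, monomialsSpan_biUnion (N := m + s + 1) B' (fun d => ?_) (fun d hd => ?_)⟩
    · refine (Finset.card_biUnion_le.trans (Finset.sum_le_sum fun d hd => ?_)).trans
        (sum_card_level_le m s k)
      refine Finset.card_image_le.trans ?_
      simp only [B', level, if_pos (Finset.mem_range.1 hd)]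
      split_ifs
      · exact hcard _ _
      · exact hcard _ _
    · rw [wordIdeal_map_finSuccEquiv]
      simp only [B']
      split_ifs with h1 h2
      · exact (hspan _ _).mono (wordIdeal_succ_le_leadingCoeffNth _ _ _ _)
      · exact (hspan _ _).mono (wordIdeal_max_le_leadingCoeffNth _ _ _ _ (by omega))
      · refine (monomialsSpan_top _).mono ?_
        rw [← wordIdeal_eq_top (X : Fin m → MvPolynomial (Fin m) ℚ) (s := s) (k := max k d)
          (by omega)]
        exact wordIdeal_max_le_leadingCoeffNth _ _ _ _ (by omega)
    · simp only [B']
      rw [if_neg (by omega), if_neg (by omega)]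

end Spanning

section Lifts

open MvPolynomial

lemma homogeneousComponent_add_mul {n a b : ℕ} {p q : MvPolynomial (Fin n) ℚ}
    (hp : p.totalDegree ≤ a) (hq : q.totalDegree ≤ b) :
    homogeneousComponent (a + b) (p * q) =
      homogeneousComponent a p * homogeneousComponent b q := by
  ext d
  by_cases hd : d.degree = a + b
  · rw [coeff_homogeneousComponent, if_pos hd, coeff_mul, coeff_mul]
    refine Finset.sum_congr rfl fun x hx => ?_
    have hdeg : x.1.degree + x.2.degree = a + b := by
      rw [← hd, ← Finset.HasAntidiagonal.mem_antidiagonal.1 hx, map_add]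
    rw [coeff_homogeneousComponent, coeff_homogeneousComponent]
    rcases lt_trichotomy x.1.degree a with h | h | h
    · rw [coeff_eq_zero_of_totalDegree_lt (f := q), mul_zero, if_neg h.ne, zero_mul]
      change _ < x.2.degree
      omega
    · rw [if_pos h, if_pos (by omega)]
    · rw [coeff_eq_zero_of_totalDegree_lt (f := p), zero_mul, if_neg h.ne', zero_mul]
      change _ < x.1.degree
      omega
  · rw [coeff_homogeneousComponent, if_neg hd]
    exact (((homogeneousComponent_isHomogeneous a p).mul
      (homogeneousComponent_isHomogeneous b q)).coeff_eq_zero hd).symm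

lemma homogeneousComponent_X_mul {n : ℕ} (i : Fin n) (p : MvPolynomial (Fin n) ℚ) (D : ℕ) :
    homogeneousComponent (D + 1) (X i * p) = X i * homogeneousComponent D p := by
  ext d
  rw [coeff_homogeneousComponent, coeff_X_mul', coeff_X_mul', coeff_homogeneousComponent]
  by_cases hi : i ∈ d.support
  · have : d.degree = (d - Finsupp.single i 1).degree + 1 := by
      conv_lhs => rw [← tsub_add_cancel_of_le (Finsupp.single_le_iff.2
        (Nat.one_le_iff_ne_zero.2 (Finsupp.mem_support_iff.1 hi)))]
      simp [map_add]
    simp [hi, this]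
  · simp [hi]

/-- `g` is the degree `e` homogeneous component of a polynomial of degree at most `e` vanishing
on `V`. -/
def HasLift {n : ℕ} (V : Set (Fin n → ℚ)) (e : ℕ) (g : MvPolynomial (Fin n) ℚ) : Prop :=
  ∃ f, f.totalDegree ≤ e ∧ homogeneousComponent e f = g ∧ ∀ x ∈ V, eval x f = 0

variable {n : ℕ} {V : Set (Fin n → ℚ)}

lemma HasLift.zero (e : ℕ) : HasLift V e 0 :=
  ⟨0, by simp, by simp, by simp⟩

lemma HasLift.add {e : ℕ} {g h : MvPolynomial (Fin n) ℚ} (hg : HasLift V e g)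
    (hh : HasLift V e h) : HasLift V e (g + h) := by
  obtain ⟨p, hp, rfl, hpV⟩ := hg
  obtain ⟨q, hq, rfl, hqV⟩ := hh
  exact ⟨p + q, (totalDegree_add _ _).trans (max_le hp hq), map_add _ _ _,
    fun x hx => by rw [map_add, hpV x hx, hqV x hx, add_zero]⟩

lemma HasLift.mul {a e : ℕ} {g p : MvPolynomial (Fin n) ℚ} (hg : HasLift V e g)
    (hp : p.totalDegree ≤ a) : HasLift V (a + e) (homogeneousComponent a p * g) := by
  obtain ⟨q, hq, rfl, hqV⟩ := hg
  exact ⟨p * q, (totalDegree_mul _ _).trans (add_le_add hp hq), homogeneousComponent_add_mul hp hq,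
    fun x hx => by rw [map_mul, hqV x hx, mul_zero]⟩

lemma HasLift.C_mul {e : ℕ} {g : MvPolynomial (Fin n) ℚ} (hg : HasLift V e g) (c : ℚ) :
    HasLift V e (C c * g) := by
  simpa [homogeneousComponent_zero] using hg.mul (p := C c) (a := 0) (by simp)

lemma HasLift.X_mul {e : ℕ} {g : MvPolynomial (Fin n) ℚ} (hg : HasLift V e g) (i : Fin n) :
    HasLift V (e + 1) (X i * g) := by
  have := hg.mul (p := X i) (a := 1) (by simp)
  rwa [homogeneousComponent_eq_self (isHomogeneous_X ℚ i), add_comm] at this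

lemma HasLift.X_pow_mul {e : ℕ} {g : MvPolynomial (Fin n) ℚ} (hg : HasLift V e g) (i : Fin n)
    (d : ℕ) : HasLift V (d + e) (X i ^ d * g) := by
  induction d with
  | zero => simpa using hg
  | succ d ih =>
    rw [pow_succ', mul_assoc, add_right_comm]
    exact ih.X_mul i

lemma homogeneousComponent_span {G : Set (MvPolynomial (Fin n) ℚ)}
    (hG : ∀ g ∈ G, ∃ e, g.IsHomogeneous e ∧ HasLift V e g) {j : MvPolynomial (Fin n) ℚ}
    (hj : j ∈ Ideal.span G) : ∀ D, homogeneousComponent D j ∈ Ideal.span G ∧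
      HasLift V D (homogeneousComponent D j) := by
  induction hj using Submodule.span_induction with
  | mem g hg =>
    intro D
    obtain ⟨e, he, hl⟩ := hG g hg
    rw [homogeneousComponent_of_mem he]
    split_ifs with h
    · subst h
      exact ⟨Ideal.subset_span hg, hl⟩
    · exact ⟨zero_mem _, .zero D⟩
  | zero => simp [HasLift.zero]
  | add x y _ _ hx hy =>
    intro D
    rw [map_add]
    exact ⟨add_mem (hx D).1 (hy D).1, (hx D).2.add (hy D).2⟩
  | smul a x _ hx =>
    rw [smul_eq_mul]
    induction a using MvPolynomial.induction_on with
    | C c =>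
      intro D
      rw [homogeneousComponent_C_mul]
      exact ⟨Ideal.mul_mem_left _ _ (hx D).1, (hx D).2.C_mul c⟩
    | add p q hp hq =>
      intro D
      rw [add_mul, map_add]
      exact ⟨add_mem (hp D).1 (hq D).1, (hp D).2.add (hq D).2⟩
    | mul_X p i hp =>
      rw [mul_right_comm, mul_comm]
      rintro (_ | D)
      · rw [homogeneousComponent_zero, coeff_X_mul', if_neg (by simp), C_0]
        exact ⟨zero_mem _, .zero 0⟩
      · rw [homogeneousComponent_X_mul]
        exact ⟨Ideal.mul_mem_left _ _ (hp D).1, (hp D).2.X_mul i⟩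

lemma span_le_gradedIdeal {G : Set (MvPolynomial (Fin n) ℚ)}
    (hG : ∀ g ∈ G, ∃ e, g.IsHomogeneous e ∧ HasLift V e g) : Ideal.span G ≤ gradedIdeal n V := by
  refine Ideal.span_le.2 fun g hg => ?_
  obtain ⟨e, -, f, hdeg, rfl, hf⟩ := hG g hg
  rcases hdeg.lt_or_eq with h | rfl
  · rw [homogeneousComponent_eq_zero _ _ h]
    exact zero_mem _
  · rcases eq_or_ne f 0 with rfl | h0
    · simp
    · exact Ideal.subset_span ⟨f, h0, hf, rfl⟩

lemma exists_eval_eq (V₀ : Finset (Fin n → ℚ)) (v : V₀ → ℚ) :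
    ∃ f : MvPolynomial (Fin n) ℚ, ∀ x : V₀, eval x.1 f = v x := by
  classical
  have hdelta (x : Fin n → ℚ) : ∃ f : MvPolynomial (Fin n) ℚ,
      eval x f = 1 ∧ ∀ y ∈ V₀, y ≠ x → eval y f = 0 := by
    have hsep (y : Fin n → ℚ) : ∃ f : MvPolynomial (Fin n) ℚ,
        eval x f = 1 ∧ (y ≠ x → eval y f = 0) := by
      by_cases h : y = x
      · exact ⟨1, by simp, fun h' => (h' h).elim⟩
      · obtain ⟨i, hi⟩ := Function.ne_iff.1 h
        have : x i - y i ≠ 0 := sub_ne_zero.2 (Ne.symm hi)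
        exact ⟨C (x i - y i)⁻¹ * (X i - C (y i)), by simp [this], by simp⟩
    choose f hf hf' using hsep
    refine ⟨∏ y ∈ V₀, f y, by simp [map_prod, hf], fun y hy hne => ?_⟩
    rw [map_prod]
    exact Finset.prod_eq_zero hy (hf' y hne)
  choose f hf hf' using hdelta
  refine ⟨∑ x : V₀, C (v x) * f x.1, fun x => ?_⟩
  rw [map_sum, Finset.sum_eq_single x]
  · simp [hf]
  · intro y _ hne
    rw [map_mul, hf' y.1 x.1 x.2 (fun h => hne (Subtype.ext h.symm)), mul_zero]
  · simp

/-- The restriction of polynomial functions to a finite set of points. -/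
noncomputable def evalOn (V₀ : Finset (Fin n → ℚ)) : MvPolynomial (Fin n) ℚ →ₗ[ℚ] (V₀ → ℚ) :=
  LinearMap.pi fun x => (aeval x.1).toLinearMap

lemma evalOn_apply (V₀ : Finset (Fin n → ℚ)) (f : MvPolynomial (Fin n) ℚ) (x : V₀) :
    evalOn V₀ f x = eval x.1 f := by
  rw [evalOn, LinearMap.pi_apply, AlgHom.toLinearMap_apply, aeval_eq_eval]

lemma homogeneousComponent_mem_span_monomial (B : Finset (Fin n →₀ ℕ)) (D : ℕ)
    {b : MvPolynomial (Fin n) ℚ}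
    (hb : b ∈ Submodule.span ℚ ((fun e => monomial e (1 : ℚ)) '' (B : Set (Fin n →₀ ℕ)))) :
    homogeneousComponent D b ∈
      Submodule.span ℚ ((fun e => monomial e (1 : ℚ)) '' (B : Set (Fin n →₀ ℕ))) := by
  induction hb using Submodule.span_induction with
  | mem g hg =>
    obtain ⟨e, he, rfl⟩ := hg
    simp only
    rw [homogeneousComponent_of_mem (isHomogeneous_monomial (1 : ℚ) rfl)]
    split_ifs
    · exact Submodule.subset_span ⟨e, he, rfl⟩
    · exact zero_mem _
  | zero => simp
  | add x y _ _ hx hy => rw [map_add]; exact add_mem hx hy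
  | smul c x _ hx => rw [map_smul]; exact Submodule.smul_mem _ _ hx

lemma exists_reduction {G : Set (MvPolynomial (Fin n) ℚ)}
    (hG : ∀ g ∈ G, ∃ e, g.IsHomogeneous e ∧ HasLift V e g) {B : Finset (Fin n →₀ ℕ)}
    (hB : MonomialsSpan B (Ideal.span G)) (D : ℕ) : ∀ f : MvPolynomial (Fin n) ℚ,
    f.totalDegree ≤ D → ∃ b ∈
      Submodule.span ℚ ((fun e => monomial e (1 : ℚ)) '' (B : Set (Fin n →₀ ℕ))),
      b.totalDegree ≤ D ∧ (∀ x ∈ V, eval x (f - b) = 0) ∧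
        homogeneousComponent D (f - b) ∈ Ideal.span G := by
  induction D using Nat.strong_induction_on with
  | _ D ih =>
  intro f hf
  have hmem : homogeneousComponent D f ∈
      Submodule.span ℚ ((fun e => monomial e (1 : ℚ)) '' (B : Set (Fin n →₀ ℕ))) ⊔
        (Ideal.span G).restrictScalars ℚ := by
    rw [MonomialsSpan] at hB
    rw [hB]
    trivial
  obtain ⟨b, hb, j, hj, hbj⟩ := Submodule.mem_sup.1 hmem
  obtain ⟨hjD, q, hq, hqj, hqV⟩ := homogeneousComponent_span hG hj D
  have hbjD := congrArg (homogeneousComponent D) hbj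
  rw [homogeneousComponent_eq_self (homogeneousComponent_isHomogeneous D f), map_add] at hbjD
  have hbD := homogeneousComponent_mem_span_monomial B D hb
  have hbdeg : (homogeneousComponent D b).totalDegree ≤ D :=
    (homogeneousComponent_isHomogeneous D b).totalDegree_le
  set b₀ := homogeneousComponent D b with hb₀
  have hb₀D : homogeneousComponent D b₀ = b₀ :=
    homogeneousComponent_eq_self (homogeneousComponent_isHomogeneous D b)
  have hrest : homogeneousComponent D (f - q - b₀) = 0 := by
    rw [map_sub, map_sub, hqj, hb₀D, ← hbjD]
    ring
  have hrestdeg : (f - q - b₀).totalDegree ≤ D :=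
    (totalDegree_sub _ _).trans (max_le ((totalDegree_sub _ _).trans (max_le hf hq)) hbdeg)
  obtain ⟨b₁, hb₁, hb₁D, hb₁deg, hb₁V⟩ : ∃ b₁ ∈
      Submodule.span ℚ ((fun e => monomial e (1 : ℚ)) '' (B : Set (Fin n →₀ ℕ))),
      homogeneousComponent D b₁ = 0 ∧ b₁.totalDegree ≤ D ∧
        ∀ x ∈ V, eval x (f - q - b₀ - b₁) = 0 := by
    by_cases hr : f - q - b₀ = 0
    · exact ⟨0, zero_mem _, map_zero _, by simp, by simp [hr]⟩
    · have hlt : (f - q - b₀).totalDegree < D := by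
        refine hrestdeg.lt_of_ne fun h => ?_
        rw [← h] at hrest
        obtain ⟨e, he, hdeg⟩ := Finset.exists_mem_eq_sup (f - q - b₀).support
          (support_nonempty.2 hr) fun e => e.sum fun _ => id
        have hc := congrArg (coeff e) hrest
        rw [coeff_homogeneousComponent,
          if_pos (show e.degree = (f - q - b₀).totalDegree from hdeg.symm), coeff_zero] at hc
        exact mem_support_iff.1 he hc
      obtain ⟨b₁, hb₁, hdeg, hV, -⟩ := ih _ hlt _ le_rfl
      exact ⟨b₁, hb₁, homogeneousComponent_eq_zero _ _ (hdeg.trans_lt hlt),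
        hdeg.trans hlt.le, hV⟩
  refine ⟨b₀ + b₁, add_mem hbD hb₁, (totalDegree_add _ _).trans (max_le hbdeg hb₁deg),
    fun x hx => ?_, ?_⟩
  · rw [show f - (b₀ + b₁) = (f - q - b₀ - b₁) + q by ring, map_add, hb₁V x hx, hqV x hx, add_zero]
  · rw [map_sub, map_add, hb₁D, hb₀D, ← hbjD, add_zero, add_sub_cancel_left]
    exact hjD

theorem span_eq_gradedIdeal {G : Set (MvPolynomial (Fin n) ℚ)}
    (hG : ∀ g ∈ G, ∃ e, g.IsHomogeneous e ∧ HasLift V e g) {B : Finset (Fin n →₀ ℕ)}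
    (hB : MonomialsSpan B (Ideal.span G)) {V₀ : Finset (Fin n → ℚ)} (hV₀ : ∀ x ∈ V₀, x ∈ V)
    (hcard : B.card ≤ V₀.card) : Ideal.span G = gradedIdeal n V := by
  classical
  refine le_antisymm (span_le_gradedIdeal hG) (Ideal.span_le.2 ?_)
  rintro _ ⟨f, -, hfV, rfl⟩
  set W := Submodule.span ℚ ((fun e => monomial e (1 : ℚ)) '' (B : Set (Fin n →₀ ℕ))) with hW
  have hfin : FiniteDimensional ℚ W := FiniteDimensional.span_of_finite ℚ (B.finite_toSet.image _)
  have hfinrank : Module.finrank ℚ W ≤ V₀.card := by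
    refine le_trans ?_ hcard
    rw [hW, ← Finset.coe_image]
    exact (finrank_span_finset_le_card _).trans Finset.card_image_le
  have hsurj : Function.Surjective ((evalOn V₀).domRestrict W) := by
    intro v
    obtain ⟨p, hp⟩ := exists_eval_eq V₀ v
    obtain ⟨b, hb, -, hbV, -⟩ := exists_reduction hG hB p.totalDegree p le_rfl
    refine ⟨⟨b, hb⟩, funext fun x => ?_⟩
    rw [LinearMap.domRestrict_apply, evalOn_apply, ← hp x, eq_comm, ← sub_eq_zero, ← map_sub]
    exact hbV _ (hV₀ _ x.2)
  have hinj : Function.Injective ((evalOn V₀).domRestrict W) := by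
    refine (LinearMap.injective_iff_surjective_of_finrank_eq_finrank ?_).2 hsurj
    have h := LinearMap.finrank_le_finrank_of_surjective hsurj
    rw [Module.finrank_fintype_fun_eq_card, Fintype.card_coe] at h ⊢
    omega
  obtain ⟨b, hb, -, hbV, hmem⟩ := exists_reduction hG hB f.totalDegree f le_rfl
  have hb0 : (⟨b, hb⟩ : W) = 0 := by
    refine hinj ?_
    rw [map_zero]
    ext x
    have := hbV _ (hV₀ _ x.2)
    rw [map_sub, hfV _ (hV₀ _ x.2), zero_sub, neg_eq_zero] at this
    rw [LinearMap.domRestrict_apply, evalOn_apply, this, Pi.zero_apply]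
  rwa [show b = 0 from congrArg Subtype.val hb0, sub_zero] at hmem

end Lifts

section Generators

open MvPolynomial

lemma esymmOn_isHomogeneous (n : ℕ) (S : Finset (Fin n)) (a : ℕ) :
    (esymmOn n S a).IsHomogeneous a := by
  refine IsHomogeneous.sum _ _ _ fun t ht => ?_
  have := IsHomogeneous.prod t (fun j => (X j : MvPolynomial (Fin n) ℚ)) (fun _ => 1)
    fun j _ => isHomogeneous_X ℚ j
  rwa [Finset.sum_const, smul_eq_mul, mul_one, (Finset.mem_powersetCard.1 ht).2] at this

lemma coeff_prod_X {n : ℕ} (S : Finset (Fin n)) {a : ℕ} (ha : a ≤ S.card) :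
    (∏ p ∈ S, (Polynomial.X + Polynomial.C (X p : MvPolynomial (Fin n) ℚ))).coeff a =
      esymmOn n S (S.card - a) :=
  Finset.prod_X_add_C_coeff _ _ ha

lemma eval_esymmOn {n : ℕ} (S : Finset (Fin n)) (x : Fin n → ℚ) {a : ℕ} (ha : a ≤ S.card) :
    eval x (esymmOn n S (S.card - a)) =
      (∏ p ∈ S, (Polynomial.X + Polynomial.C (x p))).coeff a := by
  simp [Finset.prod_X_add_C_coeff _ _ ha, esymmOn, map_sum, map_prod]

lemma exists_lift_esymmOn {n : ℕ} (S : Finset (Fin n)) {Q : Polynomial ℚ} (hQ : Q.Monic) {a : ℕ}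
    (ha : a < Q.natDegree) (haS : a ≤ S.card) : ∃ f : MvPolynomial (Fin n) ℚ,
      f.totalDegree ≤ S.card - a ∧
      homogeneousComponent (S.card - a) f = esymmOn n S (S.card - a) ∧
      ∀ x, Q ∣ ∏ p ∈ S, (Polynomial.X + Polynomial.C (x p)) → eval x f = 0 := by
  have hlow {c : ℕ} (hc : c ≤ a) :
      ((Polynomial.X ^ c : Polynomial ℚ) %ₘ Q).coeff a = if a = c then 1 else 0 := by
    rw [(Polynomial.modByMonic_eq_self_iff hQ).2, Polynomial.coeff_X_pow]
    rw [Polynomial.degree_X_pow, Polynomial.degree_eq_natDegree hQ.ne_zero]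
    exact_mod_cast hc.trans_lt ha
  refine ⟨∑ c ∈ Finset.range (S.card + 1),
    C ((Polynomial.X ^ c %ₘ Q).coeff a) * esymmOn n S (S.card - c), ?_, ?_, fun x hx => ?_⟩
  · refine totalDegree_finsetSum_le fun c hc => ?_
    rcases lt_or_ge c a with h | h
    · simp [hlow h.le, h.ne']
    · refine (totalDegree_mul _ _).trans ?_
      have := (esymmOn_isHomogeneous n S (S.card - c)).totalDegree_le
      rw [totalDegree_C]
      omega
  · rw [map_sum, Finset.sum_eq_single a]
    · rw [homogeneousComponent_C_mul, homogeneousComponent_eq_self (esymmOn_isHomogeneous _ _ _),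
        hlow le_rfl, if_pos rfl, C_1, one_mul]
    · intro c hc hne
      rw [Finset.mem_range] at hc
      rw [homogeneousComponent_C_mul, homogeneousComponent_of_mem (esymmOn_isHomogeneous _ _ _),
        if_neg (by omega), mul_zero]
    · simp only [Finset.mem_range]
      omega
  · have hdeg : (∏ p ∈ S, (Polynomial.X + Polynomial.C (x p))).natDegree < S.card + 1 := by
      rw [Nat.lt_succ_iff, Polynomial.natDegree_prod_of_monic _ _ fun _ _ =>
        Polynomial.monic_X_add_C _]
      simp
    have hsum := congrArg (fun P => (Polynomial.modByMonicHom Q P).coeff a)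
      (Polynomial.as_sum_range_C_mul_X_pow' _ hdeg)
    simp only [← Polynomial.smul_eq_C_mul, map_sum, map_smul, Polynomial.finsetSum_coeff,
      Polynomial.coeff_smul, smul_eq_mul, Polynomial.modByMonicHom_apply] at hsum
    rw [(Polynomial.modByMonic_eq_zero_iff_dvd hQ).2 hx, Polynomial.coeff_zero] at hsum
    rw [hsum, map_sum]
    refine Finset.sum_congr rfl fun c hc => ?_
    rw [map_mul, eval_C, eval_esymmOn S x (Nat.lt_succ_iff.1 (Finset.mem_range.1 hc)), mul_comm]

/-- The product of the factors of the first `r` letters. -/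
noncomputable def letterProd (α : ℕ → ℚ) (r : ℕ) : Polynomial ℚ :=
  ∏ l ∈ Finset.range r, (Polynomial.X + Polynomial.C (α (l + 1)))

lemma letterProd_monic (α : ℕ → ℚ) (r : ℕ) : (letterProd α r).Monic :=
  Polynomial.monic_prod_of_monic _ _ fun _ _ => Polynomial.monic_X_add_C _

lemma natDegree_letterProd (α : ℕ → ℚ) (r : ℕ) : (letterProd α r).natDegree = r := by
  rw [letterProd, Polynomial.natDegree_prod_of_monic _ _ fun _ _ => Polynomial.monic_X_add_C _]
  simp

lemma letterProd_dvd {n : ℕ} (α : ℕ → ℚ) {r : ℕ} {S : Finset (Fin n)} {w : Fin n → ℕ}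
    (h : ∀ l < r, ∃ p ∈ S, w p = l + 1) :
    letterProd α r ∣ ∏ p ∈ S, (Polynomial.X + Polynomial.C (α (w p))) := by
  rcases r.eq_zero_or_pos with rfl | hr
  · simp [letterProd]
  have : Nonempty (Fin n) := ⟨(h 0 hr).choose⟩
  choose! g hgS hg using h
  have hinj : Set.InjOn g (Finset.range r) := fun l hl l' hl' he => by
    have h1 := hg l (by simpa using hl)
    rw [he, hg l' (by simpa using hl')] at h1
    omega
  rw [show letterProd α r = ∏ p ∈ (Finset.range r).image g,
    (Polynomial.X + Polynomial.C (α (w p))) by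
      rw [Finset.prod_image hinj]
      exact Finset.prod_congr rfl fun l hl => by rw [hg l (Finset.mem_range.1 hl)]]
  refine Finset.prod_dvd_prod_of_subset _ _ _ fun p hp => ?_
  obtain ⟨l, hl, rfl⟩ := Finset.mem_image.1 hp
  exact hgS l (Finset.mem_range.1 hl)

lemma Packedk.exists_letter {n k : ℕ} {w : Fin n → ℕ} (h : Packedk n k w) (p : Fin n) {l : ℕ}
    (hl : 1 ≤ l) (hlp : l ≤ w p) : ∃ q, w q = l := by
  induction hlp using Nat.decreasingInduction with
  | self => exact ⟨p, rfl⟩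
  | of_succ l hlt ih => exact h.2.1 l hl (ih (by omega))

lemma hasLift_esymmOn_univ {n k : ℕ} (hkn : k ≤ n) (α : ℕ → ℚ) {j : ℕ} (hj : n - k + 1 ≤ j)
    (hjn : j ≤ n) : HasLift (packedPoints n k α) j (esymmOn n Finset.univ j) := by
  have hcard : (Finset.univ : Finset (Fin n)).card = n := Finset.card_fin n
  obtain ⟨f, hdeg, hcomp, hf⟩ := exists_lift_esymmOn (Finset.univ : Finset (Fin n))
    (letterProd_monic α k) (a := n - j) (by rw [natDegree_letterProd]; omega) (by omega)
  rw [hcard, Nat.sub_sub_self hjn] at hdeg hcomp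
  refine ⟨f, hdeg, hcomp, ?_⟩
  rintro _ ⟨w, hw, rfl⟩
  refine hf _ (letterProd_dvd α fun l hl => ?_)
  obtain ⟨p, hp⟩ := hw.2.2 (l + 1) (by omega) (by omega)
  exact ⟨p, Finset.mem_univ p, hp⟩

/-- The product of the factors `X i - α l` over the first `r` letters `l`. -/
noncomputable def varProd {n : ℕ} (α : ℕ → ℚ) (i : Fin n) (r : ℕ) : MvPolynomial (Fin n) ℚ :=
  ∏ l ∈ Finset.range r, (X i - C (α (l + 1)))

lemma totalDegree_varProd_le {n : ℕ} (α : ℕ → ℚ) (i : Fin n) (r : ℕ) :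
    (varProd α i r).totalDegree ≤ r := by
  refine (totalDegree_finsetProd _ _).trans ((Finset.sum_le_sum fun l _ =>
    (totalDegree_sub_C_le _ _).trans (totalDegree_X i).le).trans ?_)
  simp

lemma homogeneousComponent_varProd {n : ℕ} (α : ℕ → ℚ) (i : Fin n) (r : ℕ) :
    homogeneousComponent r (varProd α i r) = X i ^ r := by
  induction r with
  | zero => simp [varProd, homogeneousComponent_zero]
  | succ r ih =>
    rw [varProd, Finset.prod_range_succ, ← varProd, homogeneousComponent_add_mul
      (totalDegree_varProd_le α i r) ((totalDegree_sub_C_le _ _).trans (totalDegree_X i).le),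
      ih, map_sub, homogeneousComponent_eq_self (isHomogeneous_X ℚ i),
      homogeneousComponent_of_mem (isHomogeneous_C _ _), if_neg one_ne_zero, sub_zero, pow_succ]

lemma hasLift_X_pow_mul_esymmOn {n : ℕ} (k : ℕ) (α : ℕ → ℚ) (i : Fin n) {r d : ℕ} (hr : 1 ≤ r)
    (hrd : r ≤ d) :
    HasLift (packedPoints n k α) (d + (n - r)) (X i ^ d * esymmOn n {i}ᶜ (n - r)) := by
  have hn : 0 < n := i.pos
  obtain ⟨s, hs, hsn, hsr, hsd⟩ : ∃ s, 1 ≤ s ∧ s ≤ n ∧ n - r = n - s ∧ s ≤ d := by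
    rcases le_total r n with h | h
    · exact ⟨r, hr, h, rfl, hrd⟩
    · exact ⟨n, hn, le_rfl, by omega, h.trans hrd⟩
  have hcard : ({i}ᶜ : Finset (Fin n)).card = n - 1 := by
    rw [Finset.card_compl, Fintype.card_fin, Finset.card_singleton]
  obtain ⟨f, hdeg, hcomp, hf⟩ := exists_lift_esymmOn ({i}ᶜ : Finset (Fin n))
    (letterProd_monic α s) (a := s - 1) (by rw [natDegree_letterProd]; omega) (by omega)
  rw [hcard, show n - 1 - (s - 1) = n - s by omega] at hdeg hcomp
  have hlift : HasLift (packedPoints n k α) (s + (n - s)) (X i ^ s * esymmOn n {i}ᶜ (n - s)) := by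
    refine ⟨varProd α i s * f, (totalDegree_mul _ _).trans
      (add_le_add (totalDegree_varProd_le α i s) hdeg), ?_, ?_⟩
    · rw [homogeneousComponent_add_mul (totalDegree_varProd_le α i s) hdeg,
        homogeneousComponent_varProd, hcomp]
    · rintro _ ⟨w, hw, rfl⟩
      rw [map_mul]
      rcases le_or_gt (w i) s with h | h
      · have := hw.1 i
        rw [varProd, map_prod, Finset.prod_eq_zero (i := w i - 1)
          (Finset.mem_range.2 (by omega)), zero_mul]
        simp [Nat.sub_add_cancel this]
      · rw [hf _ (letterProd_dvd α fun l hl => ?_), mul_zero]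
        obtain ⟨q, hq⟩ := hw.exists_letter i (l := l + 1) (by omega) (by omega)
        refine ⟨q, ?_, hq⟩
        rw [Finset.mem_compl, Finset.mem_singleton]
        rintro rfl
        omega
  have := hlift.X_pow_mul i (d - s)
  rwa [← mul_assoc, ← pow_add, ← add_assoc, Nat.sub_add_cancel hsd, ← hsr] at this

lemma omitProd_eq {n : ℕ} (i : Fin n) : omitProd (X : Fin n → MvPolynomial (Fin n) ℚ) i =
    ∏ p ∈ {i}ᶜ, (Polynomial.X + Polynomial.C (X p)) := by
  rw [omitProd, ← Finset.prod_subset (Finset.subset_univ ({i}ᶜ : Finset (Fin n)))]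
  · exact Finset.prod_congr rfl fun p hp => if_neg (by simpa using hp)
  · intro p _ hp
    exact if_pos (by simpa using hp)

lemma wordIdeal_le_Jnk {n k : ℕ} (hkn : k ≤ n) : wordIdeal X 0 k ≤ Jnk n k := by
  rw [wordIdeal_le_iff]
  refine ⟨Ideal.span_le.2 ?_, fun i d => ?_⟩
  · rintro _ ⟨a, ha, rfl⟩
    have := ha 0
    rw [shiftMinor_zero, coeff_prod_X _ (by rw [Finset.card_fin]; omega), Finset.card_fin]
    exact Submodule.mem_sup_right (Ideal.subset_span ⟨_, by omega, by omega, rfl⟩)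
  · rw [← Ideal.span_singleton_mul_le_iff, minorIdeal, Ideal.span_mul_span, Ideal.span_le]
    rintro _ ⟨_, rfl, _, ⟨a, ha, rfl⟩, rfl⟩
    have := ha 0
    have hn := i.pos
    have hcard : ({i}ᶜ : Finset (Fin n)).card = n - 1 := by
      rw [Finset.card_compl, Fintype.card_fin, Finset.card_singleton]
    simp only [SetLike.mem_coe]
    rw [shiftMinor_zero, omitProd_eq]
    rcases le_or_gt (a 0) (n - 1) with h | h
    · rw [coeff_prod_X _ (by omega), hcard, Nat.sub_sub]
      exact Submodule.mem_sup_left (Ideal.subset_span ⟨i, 1 + a 0, d, by omega, by omega, rfl⟩)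
    · rw [Polynomial.coeff_eq_zero_of_natDegree_lt, mul_zero]
      · exact zero_mem _
      · refine lt_of_le_of_lt (Polynomial.natDegree_prod_le _ _) ?_
        simpa [hcard] using h

/-- The generators of `Jnk n k`. -/
def generators (n k : ℕ) : Set (MvPolynomial (Fin n) ℚ) :=
  {g | ∃ (i : Fin n) (r d : ℕ), 1 ≤ r ∧ r ≤ d ∧ g = X i ^ d * esymmOn n {i}ᶜ (n - r)} ∪
    {g | ∃ j : ℕ, n - k + 1 ≤ j ∧ j ≤ n ∧ g = esymmOn n Finset.univ j}

lemma Jnk_eq_span (n k : ℕ) : Jnk n k = Ideal.span (generators n k) :=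
  (Ideal.span_union _ _).symm

lemma generators_hasLift {n k : ℕ} (hkn : k ≤ n) (α : ℕ → ℚ) {g : MvPolynomial (Fin n) ℚ}
    (hg : g ∈ generators n k) : ∃ e, g.IsHomogeneous e ∧ HasLift (packedPoints n k α) e g := by
  rcases hg with ⟨i, r, d, hr, hrd, rfl⟩ | ⟨j, hj, hjn, rfl⟩
  · exact ⟨d + (n - r), (isHomogeneous_X_pow i d).mul (esymmOn_isHomogeneous _ _ _),
      hasLift_X_pow_mul_esymmOn k α i hr hrd⟩
  · exact ⟨j, esymmOn_isHomogeneous _ _ _, hasLift_esymmOn_univ hkn α hj hjn⟩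

end Generators

lemma image_eq_range_of_mem_words {n k : ℕ} {w : Fin n → ℕ} (hw : w ∈ words n 0 k) :
    Finset.univ.image w = Finset.range (Finset.univ.image w).card := by
  rw [mem_words] at hw
  refine Finset.eq_of_subset_of_card_le (fun x hx => ?_) (by simp)
  obtain ⟨p, -, rfl⟩ := Finset.mem_image.1 hx
  exact Finset.mem_range.2 (hw.1 p)

lemma packedk_of_mem_words {n k : ℕ} {w : Fin n → ℕ} (hw : w ∈ words n 0 k) :
    Packedk n k fun p => w p + 1 := by
  have hmem (l : ℕ) : (∃ p, w p = l) ↔ l < (Finset.univ.image w).card := by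
    rw [← Finset.mem_range, ← image_eq_range_of_mem_words hw]
    simp
  have hk := (mem_words.1 hw).2
  refine ⟨fun p => Nat.le_add_left 1 _, ?_, fun j hj hjk => ?_⟩
  · rintro i hi ⟨p, hp⟩
    have h1 := (hmem i).1 ⟨p, Nat.succ.inj hp⟩
    obtain ⟨q, hq⟩ := (hmem (i - 1)).2 (by omega)
    exact ⟨q, by simp only [hq]; omega⟩
  · obtain ⟨q, hq⟩ := (hmem (j - 1)).2 (by omega)
    exact ⟨q, by simp only [hq]; omega⟩

/-- The points of `packedPoints n k α` coming from the words in `words n 0 k`. -/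
def pointsOfWords (n k : ℕ) (α : ℕ → ℚ) : Finset (Fin n → ℚ) :=
  (words n 0 k).image fun w p => α (w p + 1)

lemma mem_packedPoints_of_mem_pointsOfWords {n k : ℕ} {α : ℕ → ℚ} {x : Fin n → ℚ}
    (hx : x ∈ pointsOfWords n k α) : x ∈ packedPoints n k α := by
  obtain ⟨w, hw, rfl⟩ := Finset.mem_image.1 hx
  exact ⟨_, packedk_of_mem_words hw, rfl⟩

lemma card_pointsOfWords {n k : ℕ} {α : ℕ → ℚ} (hα : Set.InjOn α (Set.Icc 1 n)) :
    (pointsOfWords n k α).card = (words n 0 k).card := by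
  refine Finset.card_image_of_injOn fun w hw w' hw' h => funext fun p => ?_
  have hle {w : Fin n → ℕ} (hw : w ∈ words n 0 k) : w p + 1 ∈ Set.Icc 1 n := by
    have h1 := (mem_words.1 hw).1 p
    have h2 := card_image_le n w
    exact ⟨by omega, by omega⟩
  have := hα (hle hw) (hle hw') (congrFun h p)
  omega

/-- for distinct rationals `α_1, …, α_n` and `1 ≤ k ≤ n`, the ideals
`J_{n,k}` and `T(X_{n,k})` of `ℚ[x_1, …, x_n]` are equal. -/
theorem Jnk_eq_gradedIdeal (n k : ℕ) (hk : 1 ≤ k) (hkn : k ≤ n) (α : ℕ → ℚ)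
    (hα : Set.InjOn α (Set.Icc 1 n)) :
    Jnk n k = gradedIdeal n (packedPoints n k α) := by
  obtain ⟨B, hcard, hB⟩ := exists_monomialsSpan n 0 k
  have hspan := hB.mono (wordIdeal_le_Jnk hkn)
  rw [Jnk_eq_span] at hspan ⊢
  exact span_eq_gradedIdeal (fun g hg => generators_hasLift hkn α hg) hspan
    (fun x hx => mem_packedPoints_of_mem_pointsOfWords hx)
    (hcard.trans (card_pointsOfWords hα).ge)

end PackedWords
end

section
/- For 1 ≤ k ≤ n, there is an isomorphism of ungraded S_n-representations S_{n,k} ≅ ℚ[W_{n,k}], where ℚ[W_{n,k}] is the permutation representation of S_n on the set W_{n,k} of packed words, S_n acts on ℚ[x_1,…,x_n] by permuting variables, and S_{n,k} = ℚ[x_1,…,x_n]/J_{n,k} carries the induced action. -/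
open scoped BigOperators

namespace PackedWords

section Esymm

variable {A ι : Type*} [CommRing A]

/-- The elementary symmetric function of degree `j` in the elements `x i`, `i ∈ T`. -/
def esymmIn (x : ι → A) (T : Finset ι) (j : ℕ) : A :=
  ∑ t ∈ T.powersetCard j, ∏ i ∈ t, x i

@[simp] lemma esymmIn_zero (x : ι → A) (T : Finset ι) : esymmIn x T 0 = 1 := by
  simp [esymmIn]

lemma esymmIn_eq_zero (x : ι → A) {T : Finset ι} {j : ℕ} (h : T.card < j) :
    esymmIn x T j = 0 := by
  simp [esymmIn, Finset.powersetCard_eq_empty.2 h]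

lemma esymmIn_insert [DecidableEq ι] (x : ι → A) {T : Finset ι} {a : ι} (ha : a ∉ T) (j : ℕ) :
    esymmIn x (insert a T) (j + 1) = esymmIn x T (j + 1) + x a * esymmIn x T j := by
  have hmem : ∀ t ∈ T.powersetCard j, a ∉ t := fun t ht h => ha ((Finset.mem_powersetCard.1 ht).1 h)
  rw [esymmIn, Finset.powersetCard_succ_insert ha, Finset.sum_union, Finset.sum_image]
  · rw [esymmIn, esymmIn, Finset.mul_sum]
    congr 1
    exact Finset.sum_congr rfl fun t ht => Finset.prod_insert (hmem t ht)
  · intro t ht t' ht' h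
    rw [← Finset.erase_insert (hmem t ht), ← Finset.erase_insert (hmem t' ht'), h]
  · rw [Finset.disjoint_left]
    intro t ht ht'
    obtain ⟨u, -, rfl⟩ := Finset.mem_image.1 ht'
    exact ha ((Finset.mem_powersetCard.1 ht).1 (Finset.mem_insert_self _ _))

lemma pow_mul_esymmIn_mem [DecidableEq ι] {x : ι → A} {I : Ideal A} {T : Finset ι} {a : ι}
    (ha : a ∉ T) {s : ℕ} (he : ∀ j, T.card + 1 < j + s → esymmIn x (insert a T) j ∈ I) (m : ℕ) :
    ∀ j, T.card < j + m → T.card < j + s → x a ^ m * esymmIn x T j ∈ I := by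
  induction m with
  | zero =>
    intro j hj _
    simp [esymmIn_eq_zero x (show T.card < j by omega)]
  | succ m ih =>
    intro j hj hs
    have h1 := ih (j + 1) (by omega) (by omega)
    have h2 := Ideal.mul_mem_left I (x a ^ m) (he (j + 1) (by omega))
    rw [esymmIn_insert x ha] at h2
    convert sub_mem h2 h1 using 1
    ring

end Esymm

section Spanning

variable {A ι : Type*} [CommRing A] [Algebra ℚ A]

/-- The quotient `A ⧸ I` is spanned over `ℚ` by the classes of at most `N` elements. -/
def SpannedMod (I : Ideal A) (N : ℕ) : Prop :=
  ∃ S : Finset A, S.card ≤ N ∧ ∀ f : A, ∃ s ∈ Submodule.span ℚ (S : Set A), f - s ∈ I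

lemma SpannedMod.mono {I I' : Ideal A} {N N' : ℕ} (h : SpannedMod I N) (hI : I ≤ I')
    (hN : N ≤ N') : SpannedMod I' N' := by
  obtain ⟨S, hS, h⟩ := h
  exact ⟨S, hS.trans hN, fun f => (h f).imp fun s hs => ⟨hs.1, hI hs.2⟩⟩

lemma spannedMod_of_one_mem {I : Ideal A} (h : (1 : A) ∈ I) : SpannedMod I 0 :=
  ⟨∅, by simp, fun f => ⟨0, zero_mem _, by simp [(Ideal.eq_top_iff_one I).2 h]⟩⟩

lemma SpannedMod.add_of_mul_mem {I L : Ideal A} {g : A} {N M : ℕ}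
    (h : SpannedMod (I ⊔ Ideal.span {g}) N) (hL : SpannedMod L M) (hg : ∀ f ∈ L, g * f ∈ I) :
    SpannedMod I (N + M) := by
  classical
  obtain ⟨S, hS, h⟩ := h
  obtain ⟨S', hS', h'⟩ := hL
  refine ⟨S ∪ S'.image (g * ·), (Finset.card_union_le _ _).trans
    (add_le_add hS (Finset.card_image_le.trans hS')), fun f => ?_⟩
  obtain ⟨s, hs, hfs⟩ := h f
  obtain ⟨u, hu, v, hv, huv⟩ := Submodule.mem_sup.1 hfs
  obtain ⟨q, rfl⟩ := Ideal.mem_span_singleton'.1 hv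
  obtain ⟨t, ht, hqt⟩ := h' q
  refine ⟨s + g * t, add_mem (Submodule.span_mono (by simp) hs) ?_, ?_⟩
  · have := Submodule.mem_map_of_mem (f := LinearMap.mulLeft ℚ g) ht
    rw [Submodule.map_span] at this
    refine Submodule.span_mono ?_ this
    rw [Finset.coe_union, Finset.coe_image]
    exact Set.subset_union_right
  · have := add_mem hu (hg _ hqt)
    convert this using 1
    linear_combination -huv

lemma spannedMod_of_pow_mem {I : Ideal A} {y : A} {k : ℕ} (hy : y ^ k ∈ I) (N : ℕ → ℕ)
    (h : ∀ a < k, SpannedMod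
      (Submodule.comap (LinearMap.mulLeft A (y ^ a)) (I ⊔ Ideal.span {y ^ (a + 1)})) (N a)) :
    SpannedMod I (∑ a ∈ Finset.range k, N a) := by
  have key : ∀ a ≤ k, SpannedMod (I ⊔ Ideal.span {y ^ a}) (∑ b ∈ Finset.range a, N b) := by
    intro a
    induction a with
    | zero =>
      intro _
      exact spannedMod_of_one_mem (Submodule.mem_sup_right (by simp))
    | succ a ih =>
      intro ha
      rw [Finset.sum_range_succ]
      refine SpannedMod.add_of_mul_mem (g := y ^ a) ((ih (by omega)).mono ?_ le_rfl)
        (h a (by omega)) fun f hf => hf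
      exact sup_le_sup_right le_sup_left _
  refine (key k le_rfl).mono (sup_le le_rfl ?_) le_rfl
  simpa [Ideal.span_le] using hy

/-- The number of words of length `n` over a `k`-letter alphabet in which each of `s` chosen
letters appears. -/
def coverCount (k : ℕ) : ℕ → ℕ → ℕ
  | 0, 0 => 1
  | 0, _ + 1 => 0
  | n + 1, s => s * coverCount k n (s - 1) + (k - s) * coverCount k n s

lemma exists_adjoin_sub_mem_span [DecidableEq ι] (x : ι → A) (T : Finset ι) (a : ι) {f : A}
    (hf : f ∈ Algebra.adjoin ℚ (x '' (insert a T : Finset ι))) :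
    ∃ g ∈ Algebra.adjoin ℚ (x '' T), f - g ∈ Ideal.span {x a} := by
  induction hf using Algebra.adjoin_induction with
  | mem f hf =>
    obtain ⟨i, hi, rfl⟩ := hf
    rcases Finset.mem_insert.1 hi with rfl | hi
    · exact ⟨0, zero_mem _, by simp⟩
    · exact ⟨x i, Algebra.subset_adjoin ⟨i, hi, rfl⟩, by simp⟩
  | algebraMap r => exact ⟨_, Subalgebra.algebraMap_mem _ r, by simp⟩
  | add f f' _ _ h h' =>
    obtain ⟨g, hg, h⟩ := h
    obtain ⟨g', hg', h'⟩ := h'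
    exact ⟨g + g', add_mem hg hg', by convert add_mem h h' using 1; ring⟩
  | mul f f' _ _ h h' =>
    obtain ⟨g, hg, h⟩ := h
    obtain ⟨g', hg', h'⟩ := h'
    refine ⟨g * g', mul_mem hg hg', ?_⟩
    convert add_mem (Ideal.mul_mem_right f' _ h) (Ideal.mul_mem_left _ g h') using 1
    ring

theorem spannedMod_coverCount {k : ℕ} (x : ι → A) (T : Finset ι) :
    ∀ (s : ℕ) (I : Ideal A), s ≤ k → (∀ i ∈ T, x i ^ k ∈ I) →
      (∀ j, T.card < j + s → esymmIn x T j ∈ I) →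
      (∀ f, ∃ g ∈ Algebra.adjoin ℚ (x '' T), f - g ∈ I) →
      SpannedMod I (coverCount k T.card s) := by
  classical
  induction T using Finset.induction_on with
  | empty =>
    intro s I _ _ he hadj
    rcases s with _ | s
    · refine ⟨{1}, by simp [coverCount], fun f => ?_⟩
      obtain ⟨g, hg, hfg⟩ := hadj f
      refine ⟨g, ?_, hfg⟩
      simpa [Algebra.mem_bot, Submodule.mem_span_singleton, Algebra.algebraMap_eq_smul_one]
        using hg
    · exact (spannedMod_of_one_mem (by simpa using he 0 (by simp))).mono le_rfl (Nat.zero_le _)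
  | insert a T ha ih =>
    intro s I hs hx he hadj
    rw [Finset.card_insert_of_notMem ha] at he ⊢
    have hsum : coverCount k (T.card + 1) s = ∑ b ∈ Finset.range k,
        if b < s then coverCount k T.card (s - 1) else coverCount k T.card s := by
      obtain ⟨t, rfl⟩ := Nat.exists_eq_add_of_le hs
      rw [Finset.sum_range_add, Finset.sum_congr rfl (g := fun _ => coverCount (s + t) T.card (s - 1))
        fun b hb => if_pos (Finset.mem_range.1 hb)]
      simp [coverCount]
    rw [hsum]
    refine spannedMod_of_pow_mem (hx a (Finset.mem_insert_self _ _)) _ fun b hb => ?_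
    set L := Submodule.comap (LinearMap.mulLeft A (x a ^ b)) (I ⊔ Ideal.span {x a ^ (b + 1)})
    have hIL : I ≤ L := fun f hf => Submodule.mem_sup_left (Ideal.mul_mem_left _ _ hf)
    have haL : Ideal.span {x a} ≤ L := by
      rw [Ideal.span_le, Set.singleton_subset_iff]
      exact Submodule.mem_sup_right (by
        rw [LinearMap.mulLeft_apply, ← pow_succ]; exact Ideal.mem_span_singleton_self _)
    have hxL : ∀ i ∈ T, x i ^ k ∈ L := fun i hi => hIL (hx i (Finset.mem_insert_of_mem hi))
    have hadjL : ∀ f, ∃ g ∈ Algebra.adjoin ℚ (x '' T), f - g ∈ L := by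
      intro f
      obtain ⟨g, hg, hfg⟩ := hadj f
      obtain ⟨g', hg', hgg⟩ := exists_adjoin_sub_mem_span x T a hg
      exact ⟨g', hg', by simpa using add_mem (hIL hfg) (haL hgg)⟩
    split_ifs with hbs
    · refine ih (s - 1) L (by omega) hxL (fun j hj => ?_) hadjL
      rcases j with _ | j
      · exact hIL (by simpa using he 0 (by omega))
      · have h := sub_mem (hIL (he (j + 1) (by omega)))
          (Ideal.mul_mem_right (esymmIn x T j) _ (haL (Ideal.mem_span_singleton_self _)))
        rw [esymmIn_insert x ha] at h
        simpa using h
    · refine ih s L hs hxL (fun j hj => Submodule.mem_sup_left ?_) hadjL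
      exact pow_mul_esymmIn_mem ha he b j (by omega) hj

lemma SpannedMod.finrank_le {I : Ideal A} {N : ℕ} (h : SpannedMod I N) :
    Module.Finite ℚ (A ⧸ I) ∧ Module.finrank ℚ (A ⧸ I) ≤ N := by
  classical
  obtain ⟨S, hS, h⟩ := h
  have htop : Submodule.span ℚ
      (S.image (Ideal.Quotient.mkₐ ℚ I : A → A ⧸ I) : Set (A ⧸ I)) = ⊤ := by
    refine eq_top_iff.2 fun q _ => ?_
    obtain ⟨f, rfl⟩ := Ideal.Quotient.mk_surjective q
    obtain ⟨s, hs, hfs⟩ := h f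
    rw [Ideal.Quotient.eq.2 hfs, Finset.coe_image]
    have := Submodule.mem_map_of_mem (f := (Ideal.Quotient.mkₐ ℚ I).toLinearMap) hs
    rwa [Submodule.map_span] at this
  refine ⟨⟨⟨_, htop⟩⟩, ?_⟩
  rw [← finrank_top, ← htop]
  exact (finrank_span_finset_le_card _).trans (Finset.card_image_le.trans hS)

end Spanning

section Counting

lemma card_cover (k n : ℕ) (P : Finset (Fin k)) :
    Nat.card {w : Fin n → Fin k // ∀ a ∈ P, ∃ p, w p = a} = coverCount k n P.card := by
  induction n generalizing P with
  | zero =>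
    rcases P.eq_empty_or_nonempty with rfl | ⟨a, ha⟩
    · simp [coverCount]
    · have : IsEmpty {w : Fin 0 → Fin k // ∀ a ∈ P, ∃ p, w p = a} :=
        ⟨fun w => (w.2 a ha).elim fun p _ => p.elim0⟩
      obtain ⟨m, hm⟩ := Nat.exists_eq_succ_of_ne_zero (Finset.card_pos.2 ⟨a, ha⟩).ne'
      rw [hm, Nat.card_of_isEmpty, coverCount]
  | succ n ih =>
    have e : {w : Fin (n + 1) → Fin k // ∀ a ∈ P, ∃ p, w p = a} ≃
        Σ b : Fin k, {w : Fin n → Fin k // ∀ a ∈ P.erase b, ∃ p, w p = a} :=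
      ((Fin.consEquiv (fun _ => Fin k)).symm.subtypeEquiv (q := fun w =>
        ∀ a ∈ P.erase w.1, ∃ p, w.2 p = a) (by
          intro w
          simp only [Finset.mem_erase, Fin.exists_fin_succ, Fin.consEquiv, Equiv.coe_fn_symm_mk]
          refine forall_congr' fun a => ?_
          simp only [Fin.tail]
          constructor
          · rintro h ⟨h1, h2⟩
            exact (h h2).resolve_left fun h => h1 h.symm
          · intro h h2
            by_cases h1 : w 0 = a
            · exact Or.inl h1
            · exact Or.inr (h ⟨fun h => h1 h.symm, h2⟩))).trans
      { toFun := fun w => ⟨w.1.1, w.1.2, w.2⟩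
        invFun := fun w => ⟨(w.1, w.2.1), w.2.2⟩
        left_inv := fun _ => rfl
        right_inv := fun _ => rfl }
    rw [Nat.card_congr e, Nat.card_sigma]
    simp_rw [ih, Finset.card_erase_eq_ite]
    rw [← Finset.sum_add_sum_compl P, Finset.sum_congr rfl
      (g := fun _ => coverCount k n (P.card - 1)) fun b hb => by rw [if_pos hb],
      Finset.sum_congr (s₁ := Pᶜ) rfl
      (g := fun _ => coverCount k n P.card) fun b hb => by rw [if_neg (Finset.mem_compl.1 hb)]]
    simp [coverCount, Finset.card_compl]

end Counting

section TopDegree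

open MvPolynomial

variable {σ : Type*}

/-- The polynomials of total degree less than `d`. -/
noncomputable def degreeLTSubmodule (σ : Type*) (d : ℕ) : Submodule ℚ (MvPolynomial σ ℚ) :=
  restrictSupport ℚ {m | m.degree < d}

lemma mem_degreeLTSubmodule {d : ℕ} {f : MvPolynomial σ ℚ} :
    f ∈ degreeLTSubmodule σ d ↔ ∀ m : σ →₀ ℕ, d ≤ m.degree → coeff m f = 0 := by
  rw [degreeLTSubmodule, mem_restrictSupport_iff]
  refine forall_congr' fun m => ?_
  rw [Finset.mem_coe, mem_support_iff, Set.mem_ofPred_eq, ← not_le]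
  tauto

lemma degreeLTSubmodule_mono {d e : ℕ} (h : d ≤ e) :
    degreeLTSubmodule σ d ≤ degreeLTSubmodule σ e := fun f hf => by
  rw [mem_degreeLTSubmodule] at hf ⊢
  exact fun m hm => hf m (h.trans hm)

lemma IsHomogeneous.mem_degreeLTSubmodule {d : ℕ} {f : MvPolynomial σ ℚ}
    (hf : f.IsHomogeneous d) : f ∈ degreeLTSubmodule σ (d + 1) :=
  PackedWords.mem_degreeLTSubmodule.2 fun m hm => hf.coeff_eq_zero (by omega)

lemma mul_mem_degreeLTSubmodule {a b : ℕ} {f g : MvPolynomial σ ℚ}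
    (hf : f ∈ degreeLTSubmodule σ a) (hg : g ∈ degreeLTSubmodule σ (b + 1)) :
    f * g ∈ degreeLTSubmodule σ (a + b) := by
  classical
  rw [mem_degreeLTSubmodule] at *
  intro m hm
  rw [coeff_mul]
  refine Finset.sum_eq_zero fun p hp => ?_
  rw [← Finset.HasAntidiagonal.mem_antidiagonal.1 hp, map_add] at hm
  by_cases h : a ≤ p.1.degree
  · rw [hf _ h, zero_mul]
  · rw [hg _ (by omega), mul_zero]

/-- `g` is homogeneous of degree `d`, and `f` is `g` plus terms of degree less than `d`. -/
def HasTop (d : ℕ) (f g : MvPolynomial σ ℚ) : Prop :=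
  g.IsHomogeneous d ∧ f - g ∈ degreeLTSubmodule σ d

lemma HasTop.of_isHomogeneous {d : ℕ} {g : MvPolynomial σ ℚ} (hg : g.IsHomogeneous d) :
    HasTop d g g := ⟨hg, by simp⟩

lemma HasTop.mem_degreeLTSubmodule {d : ℕ} {f g : MvPolynomial σ ℚ} (h : HasTop d f g) :
    f ∈ degreeLTSubmodule σ (d + 1) := by
  have := add_mem (degreeLTSubmodule_mono (Nat.le_succ d) h.2)
    (IsHomogeneous.mem_degreeLTSubmodule h.1)
  simpa using this

lemma HasTop.mul {d e : ℕ} {f g f' g' : MvPolynomial σ ℚ} (h : HasTop d f g)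
    (h' : HasTop e f' g') : HasTop (d + e) (f * f') (g * g') := by
  refine ⟨h.1.mul h'.1, ?_⟩
  have h1 := mul_mem_degreeLTSubmodule h.2 h'.mem_degreeLTSubmodule
  have h2 := mul_mem_degreeLTSubmodule h'.2 (IsHomogeneous.mem_degreeLTSubmodule h.1)
  rw [add_comm e d] at h2
  convert add_mem h1 h2 using 1
  ring

lemma HasTop.sub {d : ℕ} {f g r : MvPolynomial σ ℚ} (h : HasTop d f g)
    (hr : r ∈ degreeLTSubmodule σ d) : HasTop d (f - r) g := by
  refine ⟨h.1, ?_⟩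
  convert sub_mem h.2 hr using 1
  ring

lemma hasTop_prod_X_sub_C (i : σ) (α : ℕ → ℚ) (d : ℕ) :
    HasTop d (∏ m ∈ Finset.range d, (X i - C (α m))) (X i ^ d) := by
  induction d with
  | zero => simpa using HasTop.of_isHomogeneous (isHomogeneous_one σ ℚ)
  | succ d ih =>
    rw [Finset.prod_range_succ, pow_succ]
    refine ih.mul ((HasTop.of_isHomogeneous (isHomogeneous_X ℚ i)).sub ?_)
    exact IsHomogeneous.mem_degreeLTSubmodule (isHomogeneous_C σ (α d))

/-- If `J` is generated by homogeneous polynomials, each of which is the top degree component of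
a polynomial in `I`, then every homogeneous component of every element of `J` lies in `J` and
is the top degree component of a polynomial in `I`. -/
lemma homogeneousComponent_of_mem_span {I : Ideal (MvPolynomial σ ℚ)}
    {G : Set (MvPolynomial σ ℚ)} (hG : ∀ g ∈ G, ∃ d, ∃ f ∈ I, HasTop d f g)
    {g : MvPolynomial σ ℚ} (hg : g ∈ Ideal.span G) (d : ℕ) :
    homogeneousComponent d g ∈ Ideal.span G ∧ ∃ f ∈ I, HasTop d f (homogeneousComponent d g) := by
  set G' : Set (MvPolynomial σ ℚ) := {p | p ∈ Ideal.span G ∧ ∃ d, ∃ f ∈ I, HasTop d f p}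
  have hmul : ∀ a x, x ∈ Submodule.span ℚ G' → a * x ∈ Submodule.span ℚ G' := by
    intro a x hx
    induction a using MvPolynomial.induction_on' with
    | monomial m c =>
      have := Submodule.mem_map_of_mem (f := LinearMap.mulLeft ℚ (monomial m c)) hx
      rw [Submodule.map_span] at this
      refine Submodule.span_mono ?_ this
      rintro _ ⟨p, ⟨hp, e, f, hf, h⟩, rfl⟩
      exact ⟨Ideal.mul_mem_left _ _ hp, _, _, Ideal.mul_mem_left _ _ hf,
        (HasTop.of_isHomogeneous (isHomogeneous_monomial c rfl)).mul h⟩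
    | add p q hp hq => rw [add_mul]; exact add_mem hp hq
  have hspan : g ∈ Submodule.span ℚ G' := by
    induction hg using Submodule.span_induction with
    | mem x hx => exact Submodule.subset_span ⟨Ideal.subset_span hx, hG x hx⟩
    | zero => exact zero_mem _
    | add x y _ _ hx hy => exact add_mem hx hy
    | smul a x _ hx => exact hmul a x hx
  clear hg
  induction hspan using Submodule.span_induction with
  | mem x hx =>
    obtain ⟨hx, e, f, hf, h⟩ := hx
    rw [homogeneousComponent_of_mem h.1]
    split_ifs with hde
    · exact ⟨hx, f, hf, hde ▸ h⟩
    · exact ⟨zero_mem _, 0, zero_mem _, HasTop.of_isHomogeneous (isHomogeneous_zero _ _ _)⟩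
  | zero =>
    rw [map_zero]
    exact ⟨zero_mem _, 0, zero_mem _, HasTop.of_isHomogeneous (isHomogeneous_zero _ _ _)⟩
  | add x y _ _ hx hy =>
    obtain ⟨hx, f, hf, h⟩ := hx
    obtain ⟨hy, f', hf', h'⟩ := hy
    rw [map_add]
    refine ⟨add_mem hx hy, f + f', add_mem hf hf', h.1.add h'.1, ?_⟩
    convert add_mem h.2 h'.2 using 1
    ring
  | smul a x _ hx =>
    obtain ⟨hx, f, hf, h⟩ := hx
    rw [map_smul]
    refine ⟨Submodule.smul_of_tower_mem _ a hx, a • f, Submodule.smul_of_tower_mem _ a hf,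
      Submodule.smul_mem (homogeneousSubmodule σ ℚ d) a h.1, ?_⟩
    rw [← smul_sub]
    exact Submodule.smul_mem _ a h.2

end TopDegree

section MonomialPairing

open MvPolynomial

variable {σ : Type*}

/-- The bilinear form on polynomials for which the monomials are orthonormal. -/
noncomputable def monomialPairing (σ : Type*) : LinearMap.BilinForm ℚ (MvPolynomial σ ℚ) :=
  (basisMonomials σ ℚ).constr ℚ fun m => lcoeff ℚ m

lemma monomialPairing_monomial (m : σ →₀ ℕ) (c : ℚ) (g : MvPolynomial σ ℚ) :
    monomialPairing σ (monomial m c) g = c * coeff m g := by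
  have h : monomialPairing σ (monomial m 1) = lcoeff ℚ m := by
    simpa [monomialPairing] using (basisMonomials σ ℚ).constr_basis ℚ (fun m => lcoeff ℚ m) m
  rw [← mul_one c, ← smul_eq_mul, ← smul_monomial, map_smul, LinearMap.smul_apply, h]
  simp

lemma monomialPairing_apply (f g : MvPolynomial σ ℚ) :
    monomialPairing σ f g = ∑ m ∈ f.support, coeff m f * coeff m g := by
  conv_lhs => rw [f.as_sum, map_sum, LinearMap.sum_apply]
  exact Finset.sum_congr rfl fun m _ => monomialPairing_monomial m _ g

lemma monomialPairing_comm (f g : MvPolynomial σ ℚ) :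
    monomialPairing σ f g = monomialPairing σ g f := by
  classical
  induction f using MvPolynomial.induction_on' with
  | monomial m c =>
    rw [monomialPairing_monomial, monomialPairing_apply]
    simp only [coeff_monomial, mul_ite, mul_zero, Finset.sum_ite_eq, mem_support_iff]
    split_ifs with h
    · exact mul_comm _ _
    · rw [not_not.1 h, mul_zero]
  | add p q hp hq => rw [map_add, LinearMap.add_apply, map_add, hp, hq]

lemma eq_zero_of_monomialPairing_self {f : MvPolynomial σ ℚ} (h : monomialPairing σ f f = 0) :
    f = 0 := by
  rw [monomialPairing_apply,
    Finset.sum_eq_zero_iff_of_nonneg fun m _ => mul_self_nonneg _] at h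
  rw [← support_eq_empty, Finset.eq_empty_iff_forall_notMem]
  exact fun m hm => mem_support_iff.1 hm (mul_self_eq_zero.1 (h m hm))

lemma monomialPairing_rename (e : Equiv.Perm σ) (f g : MvPolynomial σ ℚ) :
    monomialPairing σ (rename e f) (rename e g) = monomialPairing σ f g := by
  induction f using MvPolynomial.induction_on' with
  | monomial m c =>
    rw [rename_monomial, monomialPairing_monomial, monomialPairing_monomial,
      coeff_rename_mapDomain _ e.injective]
  | add p q hp hq => simp only [map_add, LinearMap.add_apply, hp, hq]

lemma monomialPairing_homogeneousComponent {d : ℕ} {h : MvPolynomial σ ℚ}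
    (hh : h.IsHomogeneous d) (f : MvPolynomial σ ℚ) :
    monomialPairing σ (homogeneousComponent d f) h = monomialPairing σ f h := by
  classical
  induction f using MvPolynomial.induction_on' with
  | monomial m c =>
    rw [homogeneousComponent_of_mem (isHomogeneous_monomial c rfl)]
    split_ifs with hd
    · rfl
    · rw [monomialPairing_monomial, hh.coeff_eq_zero (Ne.symm hd)]
      simp
  | add p q hp hq => simp only [map_add, LinearMap.add_apply, hp, hq]

/-- The orthogonal complement of an ideal for the monomial pairing. -/
noncomputable def idealOrthogonal (J : Ideal (MvPolynomial σ ℚ)) :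
    Submodule ℚ (MvPolynomial σ ℚ) :=
  (monomialPairing σ).orthogonal (J.restrictScalars ℚ)

lemma mem_idealOrthogonal {J : Ideal (MvPolynomial σ ℚ)} {h : MvPolynomial σ ℚ} :
    h ∈ idealOrthogonal J ↔ ∀ g ∈ J, monomialPairing σ g h = 0 := Iff.rfl

lemma eq_zero_of_mem_idealOrthogonal {J : Ideal (MvPolynomial σ ℚ)} {h : MvPolynomial σ ℚ}
    (hh : h ∈ idealOrthogonal J) (hJ : h ∈ J) : h = 0 :=
  eq_zero_of_monomialPairing_self (mem_idealOrthogonal.1 hh h hJ)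

lemma rename_mem_idealOrthogonal {J : Ideal (MvPolynomial σ ℚ)}
    (hJ : ∀ (e : Equiv.Perm σ), ∀ f ∈ J, rename e f ∈ J) (e : Equiv.Perm σ)
    {h : MvPolynomial σ ℚ} (hh : h ∈ idealOrthogonal J) : rename e h ∈ idealOrthogonal J := by
  rw [mem_idealOrthogonal] at hh ⊢
  intro g hg
  rw [← hh _ (hJ e.symm g hg), ← monomialPairing_rename e (rename e.symm g) h,
    rename_rename, e.self_comp_symm, rename_id_apply]

lemma exists_isHomogeneous_sub_mem [Finite σ] {J : Ideal (MvPolynomial σ ℚ)}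
    (hJ : ∀ g ∈ J, ∀ d, homogeneousComponent d g ∈ J) {d : ℕ} {f : MvPolynomial σ ℚ}
    (hf : f.IsHomogeneous d) :
    ∃ h ∈ idealOrthogonal J, h.IsHomogeneous d ∧ f - h ∈ J := by
  have : Module.Finite ℚ (homogeneousSubmodule σ ℚ d) :=
    Module.Finite.iff_fg.2 (homogeneousSubmodule_fg σ ℚ d)
  set B := (monomialPairing σ).restrict (homogeneousSubmodule σ ℚ d)
  set W := (J.restrictScalars ℚ).comap (homogeneousSubmodule σ ℚ d).subtype
  have hB : B.IsRefl := fun x y hxy => (monomialPairing_comm (y : MvPolynomial σ ℚ) x).trans hxy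
  have hW : IsCompl W (B.orthogonal W) := by
    rw [LinearMap.BilinForm.isCompl_orthogonal_iff_disjoint hB, Submodule.disjoint_def]
    intro x hx hx'
    exact Subtype.ext (eq_zero_of_monomialPairing_self (hx' x hx))
  obtain ⟨g, hg, h, hh, hgh⟩ := Submodule.mem_sup.1
    (hW.sup_eq_top ▸ Submodule.mem_top : (⟨f, hf⟩ : homogeneousSubmodule σ ℚ d) ∈ W ⊔ B.orthogonal W)
  have hgh' : (g : MvPolynomial σ ℚ) + h = f := congrArg Subtype.val hgh
  refine ⟨h, fun p hp => ?_, h.2, ?_⟩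
  · change monomialPairing σ p h = 0
    rw [← monomialPairing_homogeneousComponent h.2]
    exact hh ⟨homogeneousComponent d p, homogeneousComponent_isHomogeneous d p⟩ (hJ p hp d)
  · rw [← hgh', add_sub_cancel_right]
    exact hg

lemma exists_idealOrthogonal_sub_mem [Finite σ] {I J : Ideal (MvPolynomial σ ℚ)}
    (hJ : ∀ g ∈ J, ∀ d, homogeneousComponent d g ∈ J ∧
      ∃ f ∈ I, HasTop d f (homogeneousComponent d g)) (f : MvPolynomial σ ℚ) :
    ∃ h ∈ idealOrthogonal J, f - h ∈ I := by
  have key : ∀ d, ∀ f ∈ degreeLTSubmodule σ d, ∃ h ∈ idealOrthogonal J, f - h ∈ I := by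
    intro d
    induction d with
    | zero =>
      intro f hf
      have : f = 0 := MvPolynomial.ext _ _ fun m => by
        simpa using mem_degreeLTSubmodule.1 hf m (Nat.zero_le _)
      exact ⟨0, zero_mem _, by simp [this]⟩
    | succ d ih =>
      intro f hf
      have hfd : f - homogeneousComponent d f ∈ degreeLTSubmodule σ d := by
        rw [mem_degreeLTSubmodule] at hf ⊢
        intro m hm
        rw [coeff_sub, coeff_homogeneousComponent]
        split_ifs with h
        · exact sub_self _
        · rw [hf m (by omega), sub_zero]
      obtain ⟨h, hh, hhd, hhJ⟩ := exists_isHomogeneous_sub_mem (fun g hg d => (hJ g hg d).1)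
        (homogeneousComponent_isHomogeneous d f)
      obtain ⟨-, i, hi, htop⟩ := hJ _ hhJ d
      rw [homogeneousComponent_eq_self ((homogeneousComponent_isHomogeneous d f).sub hhd)] at htop
      obtain ⟨h', hh', hI⟩ := ih (f - h - i) (by
        convert sub_mem hfd htop.2 using 1
        ring)
      refine ⟨h + h', add_mem hh hh', ?_⟩
      convert add_mem hI hi using 1
      ring
  refine key (f.totalDegree + 1) f (mem_degreeLTSubmodule.2 fun m hm => ?_)
  exact coeff_eq_zero_of_totalDegree_lt (by rwa [Nat.lt_iff_add_one_le])

lemma exists_idealOrthogonal_sub_mem_self [Finite σ] {J : Ideal (MvPolynomial σ ℚ)}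
    (hJ : ∀ g ∈ J, ∀ d, homogeneousComponent d g ∈ J) (f : MvPolynomial σ ℚ) :
    ∃ h ∈ idealOrthogonal J, f - h ∈ J :=
  exists_idealOrthogonal_sub_mem (fun g hg d => ⟨hJ g hg d, _, hJ g hg d,
    HasTop.of_isHomogeneous (homogeneousComponent_isHomogeneous d g)⟩) f

end MonomialPairing

section Deformation

open MvPolynomial

variable {A : Type*} [CommRing A]

/-- The coefficients of the product of `1 / (1 + α t)` and the power series with
coefficients `a`. -/
def deform (α : A) (a : ℕ → A) : ℕ → A
  | 0 => a 0
  | j + 1 => a (j + 1) - α * deform α a j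

lemma deform_esymmIn_insert {ι : Type*} [DecidableEq ι] (x : ι → A) {T : Finset ι} {a : ι}
    (ha : a ∉ T) (j : ℕ) : deform (x a) (esymmIn x (insert a T)) j = esymmIn x T j := by
  induction j with
  | zero => simp [deform]
  | succ j ih => rw [deform, ih, esymmIn_insert x ha, add_sub_cancel_right]

lemma map_deform {B : Type*} [CommRing B] (φ : A →+* B) (α : A) (a : ℕ → A) (j : ℕ) :
    φ (deform α a j) = deform (φ α) (fun i => φ (a i)) j := by
  induction j with
  | zero => rfl
  | succ j ih => rw [deform, map_sub, map_mul, ih, deform]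

variable {σ : Type*}

/-- The coefficients of `∏ i ∈ T, (1 + x_i t) / ∏ m ∈ {1, …, d}, (1 + m t)`. -/
noncomputable def deformedEsymm (T : Finset σ) : ℕ → ℕ → MvPolynomial σ ℚ
  | 0 => esymmIn X T
  | d + 1 => deform (C ((d + 1 : ℕ) : ℚ)) (deformedEsymm T d)

lemma hasTop_deformedEsymm (T : Finset σ) (d : ℕ) :
    ∀ j, HasTop j (deformedEsymm T d j) (esymmIn X T j) := by
  induction d with
  | zero =>
    intro j
    refine HasTop.of_isHomogeneous (IsHomogeneous.sum _ _ _ fun t ht => ?_)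
    have := IsHomogeneous.prod t (fun i => (X i : MvPolynomial σ ℚ)) (fun _ => 1)
      fun i _ => isHomogeneous_X ℚ i
    simpa [(Finset.mem_powersetCard.1 ht).2] using this
  | succ d ih =>
    intro j
    induction j with
    | zero => exact ih 0
    | succ j ihj =>
      refine (ih (j + 1)).sub ?_
      rw [← smul_eq_C_mul]
      exact Submodule.smul_mem _ _ ihj.mem_degreeLTSubmodule

lemma eval_deformedEsymm [DecidableEq σ] (w : σ → ℕ) (T : Finset σ) (d : ℕ)
    (h : ∀ m, 1 ≤ m → m ≤ d → ∃ p ∈ T, w p = m) :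
    ∃ T' : Finset σ, T'.card + d = T.card ∧ (∀ p ∈ T, d < w p → p ∈ T') ∧
      ∀ j, eval (fun p => (w p : ℚ)) (deformedEsymm T d j) =
        esymmIn (fun p => (w p : ℚ)) T' j := by
  induction d with
  | zero => exact ⟨T, rfl, fun _ hp _ => hp, fun j => by simp [deformedEsymm, esymmIn]⟩
  | succ d ih =>
    obtain ⟨T', hcard, hmem, heval⟩ := ih fun m h1 h2 => h m h1 (by omega)
    obtain ⟨p, hp, hwp⟩ := h (d + 1) (by omega) le_rfl
    have hpT : p ∈ T' := hmem p hp (by omega)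
    refine ⟨T'.erase p, ?_, fun q hq hwq => Finset.mem_erase.2 ⟨?_, hmem q hq (by omega)⟩,
      fun j => ?_⟩
    · rw [← hcard, ← Finset.card_erase_add_one hpT]
      ring
    · rintro rfl
      omega
    · rw [← deform_esymmIn_insert _ (Finset.notMem_erase p T'), Finset.insert_erase hpT,
        deformedEsymm, map_deform]
      simp_rw [heval, eval_C, hwp]

end Deformation

section PackedWordIdeal

open MvPolynomial

variable {n k : ℕ}

lemma Packedk.exists_eq {w : Fin n → ℕ} (hw : Packedk n k w) {m : ℕ} (hm : 1 ≤ m) {p : Fin n}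
    (hmp : m ≤ w p) : ∃ q, w q = m := by
  obtain ⟨t, ht⟩ := Nat.exists_eq_add_of_le hmp
  clear hmp
  induction t generalizing m with
  | zero => exact ⟨p, ht⟩
  | succ t ih => exact hw.2.1 m hm (ih (by omega) (by omega))

lemma Packedk.le {w : Fin n → ℕ} (hw : Packedk n k w) (p : Fin n) : w p ≤ n := by
  have h : Finset.Icc 1 (w p) ⊆ Finset.univ.image w := fun m hm => by
    obtain ⟨h1, h2⟩ := Finset.mem_Icc.1 hm
    obtain ⟨q, hq⟩ := hw.exists_eq h1 h2
    exact Finset.mem_image.2 ⟨q, Finset.mem_univ _, hq⟩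
  simpa using (Finset.card_le_card h).trans Finset.card_image_le

instance finite_packedk (n k : ℕ) : Finite {w : Fin n → ℕ // Packedk n k w} :=
  Finite.of_injective (fun w p => (⟨w.1 p, Nat.lt_succ_of_le (w.2.le p)⟩ : Fin (n + 1)))
    fun _ _ h => Subtype.ext (funext fun p => congrArg Fin.val (congrFun h p))

lemma card_packedk_succ_add_le (n k : ℕ) :
    Nat.card {w : Fin n → ℕ // Packedk n (k + 1) w} + coverCount k n k ≤
      Nat.card {w : Fin n → ℕ // Packedk n k w} := by
  have h := card_cover k n Finset.univ
  rw [Finset.card_fin] at h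
  rw [← h, ← Nat.card_sum]
  refine Nat.card_le_card_of_injective (Sum.elim
    (fun w => ⟨w.1, w.2.1, w.2.2.1, fun j h1 h2 => w.2.2.2 j h1 (by omega)⟩)
    fun w => ⟨fun p => w.1 p + 1, fun p => Nat.le_add_left _ _, fun i hi ⟨p, hp⟩ => ?_,
      fun j h1 h2 => ?_⟩) ?_
  · have hlt := (w.1 p).2
    have hp' : (w.1 p : ℕ) + 1 = i + 1 := hp
    obtain ⟨q, hq⟩ := w.2 ⟨i - 1, by omega⟩ (Finset.mem_univ _)
    exact ⟨q, by simp only [hq]; omega⟩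
  · obtain ⟨q, hq⟩ := w.2 ⟨j - 1, by omega⟩ (Finset.mem_univ _)
    exact ⟨q, by simp only [hq]; omega⟩
  · refine Function.Injective.sumElim ?_ ?_ ?_
    · exact fun _ _ h => Subtype.ext (congrArg Subtype.val h :)
    · intro w w' h
      refine Subtype.ext (funext fun p => Fin.ext ?_)
      simpa using congrFun (congrArg Subtype.val h) p
    · intro w w' h
      obtain ⟨p, hp⟩ := w.2.2.2 (k + 1) (by omega) le_rfl
      have := congrFun (congrArg Subtype.val h) p
      have := (w'.1 p).2
      simp only at *
      omega

/-- Evaluation of polynomials at the points `(w_1, …, w_n)`, for `w` in `W_{n,k}`. -/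
noncomputable def evalPacked (n k : ℕ) :
    MvPolynomial (Fin n) ℚ →ₐ[ℚ] ({w : Fin n → ℕ // Packedk n k w} → ℚ) :=
  AlgHom.pi fun w => aeval fun p => (w.1 p : ℚ)

lemma evalPacked_apply (f : MvPolynomial (Fin n) ℚ) (w : {w : Fin n → ℕ // Packedk n k w}) :
    evalPacked n k f w = eval (fun p => (w.1 p : ℚ)) f := by
  simp [evalPacked, aeval_eq_eval]

lemma evalPacked_surjective (n k : ℕ) : Function.Surjective (evalPacked n k) := by
  classical
  have := Fintype.ofFinite {w : Fin n → ℕ // Packedk n k w}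
  have hsep : ∀ w : {w : Fin n → ℕ // Packedk n k w}, ∃ f : MvPolynomial (Fin n) ℚ,
      evalPacked n k f = Pi.single w 1 := by
    intro w
    have hne : ∀ w' : {w : Fin n → ℕ // Packedk n k w}, w' ≠ w → ∃ p, w'.1 p ≠ w.1 p :=
      fun w' h => Function.ne_iff.1 fun h' => h (Subtype.ext h')
    choose p hp using hne
    set f : MvPolynomial (Fin n) ℚ :=
      ∏ w' : {w' // w' ≠ w}, (X (p w'.1 w'.2) - C (w'.1.1 (p w'.1 w'.2) : ℚ)) with hf
    have hfw : eval (fun p => (w.1 p : ℚ)) f ≠ 0 := by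
      rw [hf, map_prod, Finset.prod_ne_zero_iff]
      intro w' _
      rw [map_sub, eval_X, eval_C, sub_ne_zero]
      exact Nat.cast_injective.ne (hp w'.1 w'.2).symm
    refine ⟨C (eval (fun p => (w.1 p : ℚ)) f)⁻¹ * f, funext fun v => ?_⟩
    rw [evalPacked_apply, map_mul, eval_C]
    rcases eq_or_ne v w with rfl | hv
    · rw [inv_mul_cancel₀ hfw, Pi.single_eq_same]
    · have hfv : eval (fun p => (v.1 p : ℚ)) f = 0 := by
        rw [hf, map_prod]
        exact Finset.prod_eq_zero (Finset.mem_univ ⟨v, hv⟩) (by simp)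
      rw [Pi.single_eq_of_ne hv, hfv, mul_zero]
  choose f hf using hsep
  intro c
  refine ⟨∑ w, c w • f w, ?_⟩
  rw [map_sum]
  simp_rw [map_smul, hf]
  ext v
  simp [Finset.sum_apply, Pi.single_apply]

lemma exists_hasTop_of_mem_Jn_generators {i : Fin n} {r d : ℕ} (hrd : r ≤ d) :
    ∃ f ∈ RingHom.ker (evalPacked n k),
      HasTop (d + (n - r)) f (X i ^ d * esymmOn n {i}ᶜ (n - r)) := by
  refine ⟨_, ?_, (hasTop_prod_X_sub_C i (fun m => ((m + 1 : ℕ) : ℚ)) d).mul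
    (hasTop_deformedEsymm {i}ᶜ d (n - r))⟩
  rw [RingHom.mem_ker]
  ext w
  rw [evalPacked_apply, map_mul, Pi.zero_apply]
  rcases le_or_gt (w.1 i) d with hwi | hwi
  · refine mul_eq_zero_of_left ?_ _
    have h1 := w.2.1 i
    rw [map_prod]
    refine Finset.prod_eq_zero (Finset.mem_range.2 (show w.1 i - 1 < d by omega)) ?_
    rw [map_sub, eval_X, eval_C, Nat.sub_add_cancel h1, sub_self]
  · refine mul_eq_zero_of_right _ ?_
    obtain ⟨T', hcard, -, heval⟩ := eval_deformedEsymm w.1 {i}ᶜ d fun m h1 h2 => by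
      obtain ⟨q, hq⟩ := w.2.exists_eq h1 (h2.trans hwi.le)
      refine ⟨q, ?_, hq⟩
      rw [Finset.mem_compl, Finset.mem_singleton]
      rintro rfl
      omega
    rw [Finset.card_compl, Finset.card_singleton, Fintype.card_fin] at hcard
    have := i.pos
    rw [heval, esymmIn_eq_zero]
    omega

lemma exists_hasTop_esymmOn {j : ℕ} (hk : k ≤ n) (hj : n - k + 1 ≤ j) :
    ∃ f ∈ RingHom.ker (evalPacked n k), HasTop j f (esymmOn n Finset.univ j) := by
  refine ⟨_, ?_, hasTop_deformedEsymm Finset.univ k j⟩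
  rw [RingHom.mem_ker]
  ext w
  obtain ⟨T', hcard, -, heval⟩ := eval_deformedEsymm w.1 Finset.univ k fun m h1 h2 => by
    simpa using w.2.2.2 m h1 h2
  rw [Finset.card_univ, Fintype.card_fin] at hcard
  rw [evalPacked_apply, heval, esymmIn_eq_zero _ (by omega), Pi.zero_apply]

lemma homogeneousComponent_of_mem_Jnk (hk : k ≤ n) {g : MvPolynomial (Fin n) ℚ}
    (hg : g ∈ Jnk n k) (d : ℕ) : homogeneousComponent d g ∈ Jnk n k ∧
      ∃ f ∈ RingHom.ker (evalPacked n k), HasTop d f (homogeneousComponent d g) := by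
  rw [Jnk, Jn, ← Submodule.span_union] at hg ⊢
  refine homogeneousComponent_of_mem_span ?_ hg d
  rintro _ (⟨i, r, d, -, hrd, rfl⟩ | ⟨j, hj, -, rfl⟩)
  · exact ⟨_, exists_hasTop_of_mem_Jn_generators hrd⟩
  · exact ⟨_, exists_hasTop_esymmOn hk hj⟩

lemma rename_esymmOn (e : Equiv.Perm (Fin n)) (s : Finset (Fin n)) (j : ℕ) :
    rename e (esymmOn n s j) = esymmOn n (s.map e.toEmbedding) j := by
  simp [esymmOn, Finset.powersetCard_map]

lemma rename_mem_Jnk (e : Equiv.Perm (Fin n)) {f : MvPolynomial (Fin n) ℚ}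
    (hf : f ∈ Jnk n k) : rename e f ∈ Jnk n k := by
  suffices h : Jnk n k ≤ (Jnk n k).comap (rename e).toRingHom from h hf
  rw [Jnk, Jn, ← Submodule.span_union]
  refine Submodule.span_le.2 ?_
  rintro _ (⟨i, r, d, hr, hrd, rfl⟩ | ⟨j, hj, hjn, rfl⟩)
  · refine Submodule.subset_span (Or.inl ⟨e i, r, d, hr, hrd, ?_⟩)
    have : ({i}ᶜ : Finset (Fin n)).map e.toEmbedding = {e i}ᶜ := by
      ext a
      simp [← Equiv.eq_symm_apply, Finset.mem_map_equiv]
    rw [← this, ← rename_esymmOn]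
    simp
  · refine Submodule.subset_span (Or.inr ⟨j, hj, hjn, ?_⟩)
    simpa using rename_esymmOn e Finset.univ j

lemma esymmIn_univ_mem_Jnk {j : ℕ} (hj : n < j + k) (hkn : k ≤ n) :
    esymmIn X Finset.univ j ∈ Jnk n k := by
  rcases le_or_gt j n with hjn | hjn
  · exact Submodule.mem_sup_right (Ideal.subset_span ⟨j, by omega, hjn, rfl⟩)
  · rw [esymmIn_eq_zero _ (by simpa using hjn)]
    exact zero_mem _

lemma X_pow_mul_esymmIn_compl_mem_Jnk (i : Fin n) {r d : ℕ} (hr : 1 ≤ r) (hrd : r ≤ d) :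
    X i ^ d * esymmIn X {i}ᶜ (n - r) ∈ Jnk n k :=
  Submodule.mem_sup_left (Ideal.subset_span ⟨i, r, d, hr, hrd, rfl⟩)

lemma esymmIn_mul_X_pow_mem_Jnk (hk : 1 ≤ k) (hkn : k ≤ n) (i : Fin n) :
    esymmIn X Finset.univ (n - k) * X i ^ k ∈ Jnk n k := by
  have h1 := X_pow_mul_esymmIn_compl_mem_Jnk (k := k) i hk le_rfl
  rcases hkn.eq_or_lt with rfl | hlt
  · simpa using h1
  · have h2 := X_pow_mul_esymmIn_compl_mem_Jnk (k := k) i (Nat.le_add_left 1 k) le_rfl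
    obtain ⟨m, hm⟩ : ∃ m, n - k = m + 1 := ⟨n - k - 1, by omega⟩
    rw [show n - (k + 1) = m by omega] at h2
    rw [hm] at h1 ⊢
    rw [← Finset.insert_compl_self i, esymmIn_insert X (by simp)]
    convert add_mem h1 h2 using 1
    ring

lemma adjoin_X_image_univ :
    Algebra.adjoin ℚ ((X : Fin n → MvPolynomial (Fin n) ℚ) '' (Finset.univ : Finset (Fin n))) =
      ⊤ := by
  rw [Finset.coe_univ, Set.image_univ, adjoin_range_X]

lemma spannedMod_Jnk_of_sup {N : ℕ} (hk : 1 ≤ k) (hkn : k ≤ n)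
    (h : SpannedMod (Jnk n k ⊔ Ideal.span {esymmIn X Finset.univ (n - k)}) N) :
    SpannedMod (Jnk n k) (N + coverCount k n k) := by
  refine h.add_of_mul_mem (L := Submodule.comap
    (LinearMap.mulLeft (MvPolynomial (Fin n) ℚ) (esymmIn X Finset.univ (n - k))) (Jnk n k)) ?_ fun f hf => hf
  have := spannedMod_coverCount (k := k) X Finset.univ k (Submodule.comap
    (LinearMap.mulLeft (MvPolynomial (Fin n) ℚ) (esymmIn X Finset.univ (n - k))) (Jnk n k)) le_rfl
    (fun i _ => esymmIn_mul_X_pow_mem_Jnk hk hkn i)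
    (fun j hj => Ideal.mul_mem_left _ _ (esymmIn_univ_mem_Jnk (by simpa using hj) hkn))
    (fun f => ⟨f, by rw [adjoin_X_image_univ]; trivial, by simp⟩)
  simpa using this

theorem spannedMod_Jnk (hk : 1 ≤ k) (hkn : k ≤ n) :
    SpannedMod (Jnk n k) (Nat.card {w : Fin n → ℕ // Packedk n k w}) := by
  induction hkn using Nat.decreasingInduction with
  | self =>
    refine (spannedMod_Jnk_of_sup hk le_rfl (spannedMod_of_one_mem ?_)).mono le_rfl
      ((Nat.add_le_add_right (Nat.zero_le _) _).trans (card_packedk_succ_add_le n n))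
    exact Submodule.mem_sup_right (by simp)
  | of_succ k hkn ih =>
    refine (spannedMod_Jnk_of_sup hk hkn.le ((ih (by omega)).mono ?_ le_rfl)).mono le_rfl
      (card_packedk_succ_add_le n k)
    rw [Jnk, Jnk]
    refine sup_le (le_sup_left.trans le_sup_left) (Ideal.span_le.2 ?_)
    rintro _ ⟨j, hj, hjn, rfl⟩
    rcases eq_or_ne j (n - k) with rfl | hne
    · exact Submodule.mem_sup_right (Ideal.mem_span_singleton_self _)
    · exact Submodule.mem_sup_left
        (Submodule.mem_sup_right (Ideal.subset_span ⟨j, by omega, hjn, rfl⟩))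

end PackedWordIdeal

/-- for `1 ≤ k ≤ n` there is an isomorphism of ungraded `S_n`-representations
`S_{n,k} ≅ ℚ[W_{n,k}]`, where `S_n` acts on `S_{n,k} = ℚ[x_1, …, x_n]/J_{n,k}` by permuting
variables and on `ℚ[W_{n,k}]` by permuting the packed words (positionwise). -/
theorem Snk_iso_packed_words (n k : ℕ) (hk : 1 ≤ k) (hkn : k ≤ n) :
    ∃ e : (MvPolynomial (Fin n) ℚ ⧸ Jnk n k) ≃ₗ[ℚ]
        ({w : Fin n → ℕ // Packedk n k w} →₀ ℚ),
      ∀ (σ : Equiv.Perm (Fin n)) (f : MvPolynomial (Fin n) ℚ),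
        e (Ideal.Quotient.mk (Jnk n k) (MvPolynomial.rename σ f)) =
          Finsupp.equivMapDomain (wordPerm n k σ)
            (e (Ideal.Quotient.mk (Jnk n k) f)) := by
  have := Fintype.ofFinite {w : Fin n → ℕ // Packedk n k w}
  set J := Jnk n k
  have hJ := fun g hg d => homogeneousComponent_of_mem_Jnk hkn (g := g) hg d
  have hren : ∀ (e : Equiv.Perm (Fin n)), ∀ f ∈ J, MvPolynomial.rename e f ∈ J :=
    fun e _ hf => rename_mem_Jnk e hf
  obtain ⟨hfin, hrank⟩ := (spannedMod_Jnk hk hkn).finrank_le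
  let H := idealOrthogonal J
  let q : H →ₗ[ℚ] (MvPolynomial (Fin n) ℚ ⧸ J) :=
    (Ideal.Quotient.mkₐ ℚ J).toLinearMap.comp H.subtype
  let v : H →ₗ[ℚ] ({w : Fin n → ℕ // Packedk n k w} → ℚ) :=
    (evalPacked n k).toLinearMap.comp H.subtype
  have hqker : Function.Injective q := by
    rw [← LinearMap.ker_eq_bot, LinearMap.ker_eq_bot']
    exact fun h hh => Subtype.ext
      (eq_zero_of_mem_idealOrthogonal h.2 (Ideal.Quotient.eq_zero_iff_mem.1 hh))
  have hqsurj : Function.Surjective q := by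
    intro f
    obtain ⟨f, rfl⟩ := Ideal.Quotient.mk_surjective f
    obtain ⟨h, hh, hfh⟩ := exists_idealOrthogonal_sub_mem_self (fun g hg d => (hJ g hg d).1) f
    exact ⟨⟨h, hh⟩, (Ideal.Quotient.eq.2 hfh).symm⟩
  have hvsurj : Function.Surjective v := by
    intro c
    obtain ⟨f, rfl⟩ := evalPacked_surjective n k c
    obtain ⟨h, hh, hfh⟩ := exists_idealOrthogonal_sub_mem hJ f
    refine ⟨⟨h, hh⟩, ?_⟩
    rw [RingHom.mem_ker, map_sub, sub_eq_zero] at hfh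
    exact hfh.symm
  let eq := LinearEquiv.ofBijective q ⟨hqker, hqsurj⟩
  have : Module.Finite ℚ H := Module.Finite.equiv eq.symm
  have hdim : Module.finrank ℚ H = Module.finrank ℚ ({w : Fin n → ℕ // Packedk n k w} → ℚ) := by
    refine le_antisymm ?_ (LinearMap.finrank_le_finrank_of_surjective hvsurj)
    rw [eq.finrank_eq, Module.finrank_fintype_fun_eq_card, ← Nat.card_eq_fintype_card]
    exact hrank
  let ev := LinearEquiv.ofBijective v
    ⟨(LinearMap.injective_iff_surjective_of_finrank_eq_finrank hdim).2 hvsurj, hvsurj⟩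
  refine ⟨(eq.symm.trans ev).trans (Finsupp.linearEquivFunOnFinite ℚ ℚ _).symm, fun σ f => ?_⟩
  obtain ⟨h, hh⟩ := hqsurj (Ideal.Quotient.mk J f)
  have hσ : q ⟨_, rename_mem_idealOrthogonal hren σ h.2⟩ =
      Ideal.Quotient.mk J (MvPolynomial.rename σ f) := by
    refine Ideal.Quotient.eq.2 ?_
    change MvPolynomial.rename σ (h : MvPolynomial (Fin n) ℚ) - MvPolynomial.rename σ f ∈ J
    rw [← map_sub]
    exact hren σ _ (Ideal.Quotient.eq.1 hh)
  have h1 : eq.symm (Ideal.Quotient.mk J f) = h := (LinearEquiv.symm_apply_eq _).2 hh.symm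
  have h2 := (LinearEquiv.symm_apply_eq eq).2 hσ.symm
  ext w
  rw [LinearEquiv.trans_apply, LinearEquiv.trans_apply, LinearEquiv.trans_apply,
    LinearEquiv.trans_apply, h1, h2, Finsupp.equivMapDomain_apply]
  change evalPacked n k (MvPolynomial.rename σ (h : MvPolynomial (Fin n) ℚ)) w =
    evalPacked n k h ((wordPerm n k σ).symm w)
  rw [evalPacked_apply, evalPacked_apply, MvPolynomial.eval_rename]
  rfl

end PackedWords
end
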